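/- arXiv:1109.1798 — 2 statements merged into one kernel-verified Lean document; each statement's English description precedes it below -/
import Mathlib

section
/- Let g > 0, σ > 0 and ρ̃ ∈ ℝ, and assume that either ρ̃ ≤ 0, or ρ̃ > 0 and σ > ρ̃ g max{L₁², L₂²}. Then for every integer r ≥ 2 there exists a constant C > 0, depending only on r, σ, ρ̃, g, L₁, L₂, such that whenever f, φ : ℝ² → ℝ are smooth horizontally periodic functions with ∫_Q f = 0 satisfying −σ Δf − ρ̃ g f = φ on ℝ², one has Σ_{k=0}^{r} ∫_Q ‖D^k f(x)‖² dx ≤ C Σ_{k=0}^{r−2} ∫_Q ‖D^k φ(x)‖² dx, where D^k denotes the k-th total (Fréchet) derivative and ‖·‖ its norm. -/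
open MeasureTheory

/-- The periodic cell `Q = [0, 2πL₁] × [0, 2πL₂]`. -/
def Qcell (L₁ L₂ : ℝ) : Set (ℝ × ℝ) :=
  Set.Icc 0 (2 * Real.pi * L₁) ×ˢ Set.Icc 0 (2 * Real.pi * L₂)

/-- The Laplacian of `f : ℝ² → ℝ` at `x`. -/
noncomputable def lap2 (f : ℝ × ℝ → ℝ) (x : ℝ × ℝ) : ℝ :=
  fderiv ℝ (fun y => fderiv ℝ f y (1, 0)) x (1, 0)
    + fderiv ℝ (fun y => fderiv ℝ f y (0, 1)) x (0, 1)

/-! ### One-dimensional sharp Wirtinger inequality -/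

theorem wirtinger1 (L : ℝ) (hL : 0 < L) (u u' : ℝ → ℝ) (hu : ∀ x, HasDerivAt u (u' x) x)
    (hu' : Continuous u') (hper : u (2 * Real.pi * L) = u 0) :
    (∫ x in Set.Icc 0 (2 * Real.pi * L), u x ^ 2)
      - (∫ x in Set.Icc 0 (2 * Real.pi * L), u x) ^ 2 / (2 * Real.pi * L)
      ≤ L ^ 2 * ∫ x in Set.Icc 0 (2 * Real.pi * L), u' x ^ 2 := by
  have hpi := Real.pi_pos
  set T : ℝ := 2 * Real.pi * L with hT
  have hT0 : (0 : ℝ) < T := by positivity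
  have hcu : Continuous u := continuous_iff_continuousAt.2 fun x => (hu x).continuousAt
  have hmem : ∀ v : ℝ → ℝ, Continuous v →
      MemLp (fun x => (v x : ℂ)) 2 (volume.restrict (Set.Ioc 0 T)) := by
    intro v hv
    have h1 : Continuous (fun x => (v x : ℂ)) := by fun_prop
    rw [memLp_two_iff_integrable_sq_norm h1.aestronglyMeasurable]
    have h2 : IntegrableOn (fun x => ‖(v x : ℂ)‖ ^ 2) (Set.Icc 0 T) :=
      (by fun_prop : Continuous (fun x => ‖(v x : ℂ)‖ ^ 2)).continuousOn.integrableOn_compact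
        isCompact_Icc
    exact h2.mono_set Set.Ioc_subset_Icc_self
  have ha := hasSum_sq_fourierCoeffOn hT0 (hmem u hcu)
  have hb := hasSum_sq_fourierCoeffOn hT0 (hmem u' hu')
  have hconv : ∀ v : ℝ → ℝ, (∫ x in (0:ℝ)..T, v x) = ∫ x in Set.Icc 0 T, v x := by
    intro v
    rw [intervalIntegral.integral_of_le hT0.le, integral_Icc_eq_integral_Ioc]
  have h0 : ‖fourierCoeffOn hT0 (fun x => (u x : ℂ)) 0‖ ^ 2
      = (∫ x in Set.Icc 0 T, u x) ^ 2 / T ^ 2 := by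
    rw [fourierCoeffOn_eq_integral, ← hconv]
    simp only [neg_zero, fourier_zero, one_smul, sub_zero]
    rw [intervalIntegral.integral_ofReal, norm_smul, Complex.norm_real, mul_pow]
    simp only [Real.norm_eq_abs, sq_abs]
    field_simp
  have hn : ∀ n : ℤ, n ≠ 0 → ‖fourierCoeffOn hT0 (fun x => (u x : ℂ)) n‖ ^ 2
      ≤ L ^ 2 * ‖fourierCoeffOn hT0 (fun x => (u' x : ℂ)) n‖ ^ 2 := by
    intro n hn
    rw [fourierCoeffOn_of_hasDerivAt hT0 hn (f' := fun x => (u' x : ℂ))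
      (fun x _ => (hu x).ofReal_comp)
      ((Complex.continuous_ofReal.comp hu').intervalIntegrable _ _)]
    rw [hper, sub_self, mul_zero, zero_sub, norm_mul, norm_neg, norm_mul]
    have e1 : ‖(T : ℂ) - ((0 : ℝ) : ℂ)‖ = T := by
      simp [abs_of_pos hT0]
    have e2 : ‖(1 : ℂ) / (-2 * Real.pi * Complex.I * n)‖ = 1 / (2 * Real.pi * |(n : ℝ)|) := by
      simp [abs_of_pos hpi]
    rw [e1, e2]
    have hn1 : (1 : ℝ) ≤ |(n : ℝ)| := by exact_mod_cast Int.one_le_abs hn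
    rw [← mul_pow]
    have h3 : 1 / (2 * Real.pi * |(n : ℝ)|) * T ≤ L := by
      rw [hT, div_mul_eq_mul_div, div_le_iff₀ (by positivity)]
      have : 0 ≤ 2 * Real.pi * L := hT0.le
      nlinarith
    rw [← mul_assoc]
    gcongr
  have hc : HasSum (fun n : ℤ => L ^ 2 * ‖fourierCoeffOn hT0 (fun x => (u' x : ℂ)) n‖ ^ 2
      + if n = 0 then (∫ x in Set.Icc 0 T, u x) ^ 2 / T ^ 2 else 0) _ :=
    (hb.mul_left (L ^ 2)).add (hasSum_ite_eq (0 : ℤ) _)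
  have hle := hasSum_le (fun n => ?_) ha hc
  · simp only [Complex.norm_real, Real.norm_eq_abs, sq_abs, hconv, sub_zero, smul_eq_mul] at hle
    have h5 := mul_le_mul_of_nonneg_left hle hT0.le
    have h6 : T * (L ^ 2 * (T⁻¹ * ∫ x in Set.Icc 0 T, u' x ^ 2)
        + (∫ x in Set.Icc 0 T, u x) ^ 2 / T ^ 2)
        = L ^ 2 * (∫ x in Set.Icc 0 T, u' x ^ 2) + (∫ x in Set.Icc 0 T, u x) ^ 2 / T := by
      field_simp
    rw [h6, mul_inv_cancel_left₀ hT0.ne'] at h5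
    linarith
  · by_cases h : n = 0
    · subst h
      simp only [h0, if_true]
      have : 0 ≤ L ^ 2 * ‖fourierCoeffOn hT0 (fun x => (u' x : ℂ)) 0‖ ^ 2 := by positivity
      linarith
    · simp only [h, if_false, add_zero]
      exact hn n h

/-! ### Calculus on the cell -/

theorem Qcell_isCompact (L₁ L₂ : ℝ) : IsCompact (Qcell L₁ L₂) :=
  isCompact_Icc.prod isCompact_Icc

theorem intQ (L₁ L₂ : ℝ) {h : ℝ × ℝ → ℝ} (hh : Continuous h) :
    IntegrableOn h (Qcell L₁ L₂) :=
  hh.continuousOn.integrableOn_compact (Qcell_isCompact L₁ L₂)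

theorem fubini1 (L₁ L₂ : ℝ) {h : ℝ × ℝ → ℝ} (hh : Continuous h) :
    (∫ z in Qcell L₁ L₂, h z) = ∫ x in Set.Icc 0 (2 * Real.pi * L₁),
      ∫ y in Set.Icc 0 (2 * Real.pi * L₂), h (x, y) := by
  have := intQ L₁ L₂ hh
  unfold Qcell at *
  rw [Measure.volume_eq_prod] at *
  exact setIntegral_prod h this

theorem fubini2 (L₁ L₂ : ℝ) {h : ℝ × ℝ → ℝ} (hh : Continuous h) :
    (∫ z in Qcell L₁ L₂, h z) = ∫ y in Set.Icc 0 (2 * Real.pi * L₂),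
      ∫ x in Set.Icc 0 (2 * Real.pi * L₁), h (x, y) := by
  have := intQ L₁ L₂ hh
  unfold Qcell at *
  rw [Measure.volume_eq_prod] at *
  rw [IntegrableOn, ← Measure.prod_restrict] at this
  rw [← Measure.prod_restrict]
  exact integral_prod_symm h this

theorem cont_slice1 (T : ℝ) {h : ℝ × ℝ → ℝ} (hh : Continuous h) :
    Continuous (fun y => ∫ x in Set.Icc 0 T, h (x, y)) :=
  continuous_parametric_integral_of_continuous (f := fun y x => h (x, y))
    (by simp only [Function.uncurry_def]; fun_prop) isCompact_Icc

theorem cont_slice2 (T : ℝ) {h : ℝ × ℝ → ℝ} (hh : Continuous h) :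
    Continuous (fun x => ∫ y in Set.Icc 0 T, h (x, y)) :=
  continuous_parametric_integral_of_continuous (f := fun x y => h (x, y))
    (by simp only [Function.uncurry_def]; fun_prop) isCompact_Icc

theorem efron_stein (L₁ L₂ : ℝ) (hL₁ : 0 < L₁) (hL₂ : 0 < L₂) {f : ℝ × ℝ → ℝ}
    (hf : Continuous f) (h0 : (∫ z in Qcell L₁ L₂, f z) = 0) :
    (∫ y in Set.Icc 0 (2 * Real.pi * L₂),
        (∫ x in Set.Icc 0 (2 * Real.pi * L₁), f (x, y)) ^ 2) / (2 * Real.pi * L₁)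
      + (∫ x in Set.Icc 0 (2 * Real.pi * L₁),
        (∫ y in Set.Icc 0 (2 * Real.pi * L₂), f (x, y)) ^ 2) / (2 * Real.pi * L₂)
      ≤ ∫ z in Qcell L₁ L₂, f z ^ 2 := by
  have hpi := Real.pi_pos
  set T₁ := 2 * Real.pi * L₁ with hT₁
  set T₂ := 2 * Real.pi * L₂ with hT₂
  have p1 : 0 < T₁ := by positivity
  have p2 : 0 < T₂ := by positivity
  set a : ℝ → ℝ := fun y => ∫ x in Set.Icc 0 T₁, f (x, y) with ha
  set b : ℝ → ℝ := fun x => ∫ y in Set.Icc 0 T₂, f (x, y) with hb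
  have ca : Continuous a := cont_slice1 T₁ hf
  have cb : Continuous b := cont_slice2 T₂ hf
  have v1 : (volume.real (Set.Icc 0 T₁)) = T₁ := by simp [p1.le]
  have v2 : (volume.real (Set.Icc 0 T₂)) = T₂ := by simp [p2.le]
  have ia0 : (∫ y in Set.Icc 0 T₂, a y) = 0 := by
    have := fubini2 L₁ L₂ hf
    rw [h0] at this
    exact this.symm
  have i1 : (∫ z in Qcell L₁ L₂, f z * a z.2) = ∫ y in Set.Icc 0 T₂, a y ^ 2 := by
    rw [fubini2 _ _ (by fun_prop)]
    refine integral_congr_ae (Filter.Eventually.of_forall fun y => ?_)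
    simp only []
    rw [integral_mul_const, sq]
  have i2 : (∫ z in Qcell L₁ L₂, f z * b z.1) = ∫ x in Set.Icc 0 T₁, b x ^ 2 := by
    rw [fubini1 _ _ (by fun_prop)]
    refine integral_congr_ae (Filter.Eventually.of_forall fun y => ?_)
    simp only []
    rw [integral_mul_const, sq]
  have i3 : (∫ z in Qcell L₁ L₂, a z.2 ^ 2) = T₁ * ∫ y in Set.Icc 0 T₂, a y ^ 2 := by
    rw [fubini1 _ _ (by fun_prop)]
    simp only []
    rw [setIntegral_const, ← hT₁, v1, smul_eq_mul]
  have i4 : (∫ z in Qcell L₁ L₂, b z.1 ^ 2) = T₂ * ∫ x in Set.Icc 0 T₁, b x ^ 2 := by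
    rw [fubini2 _ _ (by fun_prop)]
    simp only []
    rw [setIntegral_const, ← hT₂, v2, smul_eq_mul]
  have i5 : (∫ z in Qcell L₁ L₂, a z.2 * b z.1) = 0 := by
    rw [fubini1 _ _ (by fun_prop)]
    simp only [integral_mul_const]
    rw [← hT₂, ia0]
    simp
  have hpos : 0 ≤ ∫ z in Qcell L₁ L₂, (f z - T₁⁻¹ * a z.2 - T₂⁻¹ * b z.1) ^ 2 :=
    integral_nonneg fun z => sq_nonneg _
  have hexp : (∫ z in Qcell L₁ L₂, (f z - T₁⁻¹ * a z.2 - T₂⁻¹ * b z.1) ^ 2)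
      = (∫ z in Qcell L₁ L₂, f z ^ 2) + T₁⁻¹ ^ 2 * (∫ z in Qcell L₁ L₂, a z.2 ^ 2)
        + T₂⁻¹ ^ 2 * (∫ z in Qcell L₁ L₂, b z.1 ^ 2)
        + (-2 * T₁⁻¹) * (∫ z in Qcell L₁ L₂, f z * a z.2)
        + (-2 * T₂⁻¹) * (∫ z in Qcell L₁ L₂, f z * b z.1)
        + (2 * T₁⁻¹ * T₂⁻¹) * (∫ z in Qcell L₁ L₂, a z.2 * b z.1) := by
    simp only [← integral_const_mul]
    rw [← integral_add, ← integral_add, ← integral_add, ← integral_add, ← integral_add]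
    · congr 1
      ext z
      ring
    all_goals exact intQ _ _ (by fun_prop)
  rw [hexp, i1, i2, i3, i4, i5] at hpos
  set A := ∫ y in Set.Icc 0 T₂, a y ^ 2
  set B := ∫ y in Set.Icc 0 T₁, b y ^ 2
  have : T₁⁻¹ ^ 2 * (T₁ * A) = A / T₁ := by field_simp
  have : T₂⁻¹ ^ 2 * (T₂ * B) = B / T₂ := by field_simp
  have : (-2 * T₁⁻¹) * A = -2 * (A / T₁) := by field_simp
  have : (-2 * T₂⁻¹) * B = -2 * (B / T₂) := by field_simp
  linarith

/-! ### Smooth periodic functions -/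

/-- smooth horizontally periodic functions -/
structure SPer (L₁ L₂ : ℝ) (u : ℝ × ℝ → ℝ) : Prop where
  smooth : ContDiff ℝ (⊤ : ℕ∞) u
  per1 : ∀ x₁ x₂ : ℝ, u (x₁ + 2 * Real.pi * L₁, x₂) = u (x₁, x₂)
  per2 : ∀ x₁ x₂ : ℝ, u (x₁, x₂ + 2 * Real.pi * L₂) = u (x₁, x₂)

/-- directional derivative -/
noncomputable def DD (v : ℝ × ℝ) (u : ℝ × ℝ → ℝ) : ℝ × ℝ → ℝ := fun x => fderiv ℝ u x v

theorem DD_smooth (v : ℝ × ℝ) {u : ℝ × ℝ → ℝ} (hu : ContDiff ℝ (⊤ : ℕ∞) u) :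
    ContDiff ℝ (⊤ : ℕ∞) (DD v u) :=
  (hu.fderiv_right (m := (⊤ : ℕ∞)) (by exact_mod_cast le_rfl)).clm_apply contDiff_const

theorem fderiv_shift {u : ℝ × ℝ → ℝ} (c : ℝ × ℝ) (h : ∀ x, u (x + c) = u x) (x : ℝ × ℝ) :
    fderiv ℝ u (x + c) = fderiv ℝ u x := by
  rw [← fderiv_comp_add_right]
  congr 1
  funext y
  exact h y

theorem SPer.DD {L₁ L₂ : ℝ} {u : ℝ × ℝ → ℝ} (hu : SPer L₁ L₂ u) (v : ℝ × ℝ) :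
    SPer L₁ L₂ (DD v u) where
  smooth := DD_smooth v hu.smooth
  per1 x₁ x₂ := by
    have := fderiv_shift (u := u) (2 * Real.pi * L₁, 0)
      (fun x => by obtain ⟨a, b⟩ := x; simpa using hu.per1 a b) (x₁, x₂)
    simp only [Prod.mk_add_mk, add_zero] at this
    simp only [_root_.DD, this]
  per2 x₁ x₂ := by
    have := fderiv_shift (u := u) (0, 2 * Real.pi * L₂)
      (fun x => by obtain ⟨a, b⟩ := x; simpa using hu.per2 a b) (x₁, x₂)
    simp only [Prod.mk_add_mk, add_zero] at this
    simp only [_root_.DD, this]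

theorem SPer.cont {L₁ L₂ : ℝ} {u : ℝ × ℝ → ℝ} (hu : SPer L₁ L₂ u) : Continuous u :=
  hu.smooth.continuous

theorem SPer.diff {L₁ L₂ : ℝ} {u : ℝ × ℝ → ℝ} (hu : SPer L₁ L₂ u) : Differentiable ℝ u :=
  hu.smooth.differentiable (by simp)

theorem SPer.mul {L₁ L₂ : ℝ} {u w : ℝ × ℝ → ℝ} (hu : SPer L₁ L₂ u) (hw : SPer L₁ L₂ w) :
    SPer L₁ L₂ (fun x => u x * w x) where
  smooth := hu.smooth.mul hw.smooth
  per1 x₁ x₂ := by simp only [hu.per1, hw.per1]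
  per2 x₁ x₂ := by simp only [hu.per2, hw.per2]

theorem DD_mul {u w : ℝ × ℝ → ℝ} (hu : Differentiable ℝ u) (hw : Differentiable ℝ w)
    (v x : ℝ × ℝ) : DD v (fun x => u x * w x) x = DD v u x * w x + u x * DD v w x := by
  simp only [DD]
  rw [fderiv_fun_mul (hu x) (hw x)]
  simp
  ring

theorem DD_comm {u : ℝ × ℝ → ℝ} (hu : ContDiff ℝ (⊤ : ℕ∞) u) (v w : ℝ × ℝ) :
    DD v (DD w u) = DD w (DD v u) := by
  have hd : Differentiable ℝ (fderiv ℝ u) :=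
    (hu.fderiv_right (m := (⊤ : ℕ∞)) (by exact_mod_cast le_rfl)).differentiable (by simp)
  have key : ∀ v w x, DD v (DD w u) x = fderiv ℝ (fderiv ℝ u) x v w := by
    intro v w x
    change fderiv ℝ (fun y => fderiv ℝ u y w) x v = _
    rw [fderiv_clm_apply (hd x) (differentiableAt_const _)]
    simp
  funext x
  rw [key, key]
  exact (hu.contDiffAt.isSymmSndFDerivAt (by
    rw [minSmoothness_of_isRCLikeNormedField]
    exact WithTop.coe_le_coe.2 (le_top : (2 : ℕ∞) ≤ ⊤))).eq v w

theorem hasDeriv1 {u : ℝ × ℝ → ℝ} (hu : Differentiable ℝ u) (x y : ℝ) :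
    HasDerivAt (fun s => u (s, y)) (DD (1, 0) u (x, y)) x := by
  have h1 : HasDerivAt (fun s : ℝ => (s, y)) ((1 : ℝ), (0 : ℝ)) x :=
    (hasDerivAt_id x).prodMk (hasDerivAt_const x y)
  exact (hu (x, y)).hasFDerivAt.comp_hasDerivAt x h1

theorem hasDeriv2 {u : ℝ × ℝ → ℝ} (hu : Differentiable ℝ u) (x y : ℝ) :
    HasDerivAt (fun s => u (x, s)) (DD (0, 1) u (x, y)) y := by
  have h1 : HasDerivAt (fun s : ℝ => (x, s)) ((0 : ℝ), (1 : ℝ)) y :=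
    (hasDerivAt_const y x).prodMk (hasDerivAt_id y)
  exact (hu (x, y)).hasFDerivAt.comp_hasDerivAt y h1

theorem int_deriv_zero (T : ℝ) (hT : 0 ≤ T) (u u' : ℝ → ℝ) (hu : ∀ x, HasDerivAt u (u' x) x)
    (hu' : Continuous u') (hper : u T = u 0) : (∫ x in Set.Icc 0 T, u' x) = 0 := by
  rw [integral_Icc_eq_integral_Ioc, ← intervalIntegral.integral_of_le hT,
    intervalIntegral.integral_eq_sub_of_hasDerivAt (fun x _ => hu x)
      (hu'.intervalIntegrable _ _), hper, sub_self]

theorem SPer.int1 {L₁ L₂ : ℝ} (hL₁ : 0 < L₁) {u : ℝ × ℝ → ℝ} (hu : SPer L₁ L₂ u) :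
    (∫ z in Qcell L₁ L₂, _root_.DD (1, 0) u z) = 0 := by
  have hc := (hu.DD (1, 0)).cont
  rw [fubini2 _ _ hc]
  refine integral_eq_zero_of_ae (Filter.Eventually.of_forall fun y => ?_)
  refine int_deriv_zero _ (by positivity) (fun s => u (s, y)) _
    (fun x => hasDeriv1 hu.diff x y) (by fun_prop) ?_
  simpa using hu.per1 0 y

theorem SPer.int2 {L₁ L₂ : ℝ} (hL₂ : 0 < L₂) {u : ℝ × ℝ → ℝ} (hu : SPer L₁ L₂ u) :
    (∫ z in Qcell L₁ L₂, _root_.DD (0, 1) u z) = 0 := by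
  have hc := (hu.DD (0, 1)).cont
  rw [fubini1 _ _ hc]
  refine integral_eq_zero_of_ae (Filter.Eventually.of_forall fun x => ?_)
  refine int_deriv_zero _ (by positivity) (fun s => u (x, s)) _
    (fun y => hasDeriv2 hu.diff x y) (by fun_prop) ?_
  simpa using hu.per2 x 0

theorem ibp {L₁ L₂ : ℝ} {u w : ℝ × ℝ → ℝ} (hu : SPer L₁ L₂ u) (hw : SPer L₁ L₂ w) (v : ℝ × ℝ)
    (h : ∀ u, SPer L₁ L₂ u → (∫ z in Qcell L₁ L₂, DD v u z) = 0) :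
    (∫ z in Qcell L₁ L₂, DD v u z * w z) = - ∫ z in Qcell L₁ L₂, u z * DD v w z := by
  have h1 := h _ (hu.mul hw)
  have c1 := hu.cont
  have c2 := hw.cont
  have c3 := (hu.DD v).cont
  have c4 := (hw.DD v).cont
  simp only [DD_mul hu.diff hw.diff] at h1
  rw [integral_add (intQ _ _ (by fun_prop)) (intQ _ _ (by fun_prop))] at h1
  linarith

/-- Sharp Poincaré inequality on the cell. -/
theorem poincare {L₁ L₂ : ℝ} (hL₁ : 0 < L₁) (hL₂ : 0 < L₂) {u : ℝ × ℝ → ℝ} (hu : SPer L₁ L₂ u)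
    (h0 : (∫ z in Qcell L₁ L₂, u z) = 0) :
    (∫ z in Qcell L₁ L₂, u z ^ 2) ≤ max (L₁ ^ 2) (L₂ ^ 2) *
      ((∫ z in Qcell L₁ L₂, DD (1, 0) u z ^ 2) + ∫ z in Qcell L₁ L₂, DD (0, 1) u z ^ 2) := by
  have c := hu.cont
  have c1 := (hu.DD (1, 0)).cont
  have c2 := (hu.DD (0, 1)).cont
  have hes := efron_stein L₁ L₂ hL₁ hL₂ c h0
  have iI : ∀ (T : ℝ) (v : ℝ → ℝ), Continuous v → IntegrableOn v (Set.Icc 0 T) :=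
    fun T v hv => hv.continuousOn.integrableOn_compact isCompact_Icc
  have s1 := cont_slice1 (2 * Real.pi * L₁) c
  have s2 := cont_slice2 (2 * Real.pi * L₂) c
  have s1' := cont_slice1 (2 * Real.pi * L₁) (c.pow 2)
  have s2' := cont_slice2 (2 * Real.pi * L₂) (c.pow 2)
  have s1'' := cont_slice1 (2 * Real.pi * L₁) (c1.pow 2)
  have s2'' := cont_slice2 (2 * Real.pi * L₂) (c2.pow 2)
  simp only [Pi.pow_apply] at s1' s2' s1'' s2''
  have w1 : (∫ z in Qcell L₁ L₂, u z ^ 2) - (∫ y in Set.Icc 0 (2 * Real.pi * L₂),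
        (∫ x in Set.Icc 0 (2 * Real.pi * L₁), u (x, y)) ^ 2) / (2 * Real.pi * L₁)
        ≤ L₁ ^ 2 * (∫ z in Qcell L₁ L₂, DD (1, 0) u z ^ 2) := by
    rw [fubini2 L₁ L₂ (h := fun z => u z ^ 2) (c.pow 2), fubini2 L₁ L₂ (h := fun z => DD (1, 0) u z ^ 2) (c1.pow 2), ← integral_div, ← integral_const_mul,
      ← integral_sub (iI _ _ s1') (iI _ _ (by fun_prop))]
    refine integral_mono (iI _ _ (by fun_prop)) (iI _ _ (by fun_prop)) fun y => ?_
    exact wirtinger1 L₁ hL₁ (fun s => u (s, y)) _ (fun x => hasDeriv1 hu.diff x y) (by fun_prop)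
      (by simpa using hu.per1 0 y)
  have w2 : (∫ z in Qcell L₁ L₂, u z ^ 2) - (∫ x in Set.Icc 0 (2 * Real.pi * L₁),
        (∫ y in Set.Icc 0 (2 * Real.pi * L₂), u (x, y)) ^ 2) / (2 * Real.pi * L₂)
        ≤ L₂ ^ 2 * (∫ z in Qcell L₁ L₂, DD (0, 1) u z ^ 2) := by
    rw [fubini1 L₁ L₂ (h := fun z => u z ^ 2) (c.pow 2), fubini1 L₁ L₂ (h := fun z => DD (0, 1) u z ^ 2) (c2.pow 2), ← integral_div, ← integral_const_mul,
      ← integral_sub (iI _ _ s2') (iI _ _ (by fun_prop))]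
    refine integral_mono (iI _ _ (by fun_prop)) (iI _ _ (by fun_prop)) fun x => ?_
    exact wirtinger1 L₂ hL₂ (fun s => u (x, s)) _ (fun y => hasDeriv2 hu.diff x y) (by fun_prop)
      (by simpa using hu.per2 x 0)
  have n1 : 0 ≤ ∫ z in Qcell L₁ L₂, DD (1, 0) u z ^ 2 := integral_nonneg fun z => sq_nonneg _
  have n2 : 0 ≤ ∫ z in Qcell L₁ L₂, DD (0, 1) u z ^ 2 := integral_nonneg fun z => sq_nonneg _
  have m1 := mul_le_mul_of_nonneg_right (le_max_left (L₁ ^ 2) (L₂ ^ 2)) n1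
  have m2 := mul_le_mul_of_nonneg_right (le_max_right (L₁ ^ 2) (L₂ ^ 2)) n2
  rw [mul_add]
  linarith

/-- `H²` estimate in terms of the second partial derivatives. -/
theorem h2_est {L₁ L₂ : ℝ} (hL₁ : 0 < L₁) (hL₂ : 0 < L₂)
    (g σ ρt : ℝ) (hg : 0 < g) (hσ : 0 < σ)
    (hcase : ρt ≤ 0 ∨ (0 < ρt ∧ ρt * g * max (L₁ ^ 2) (L₂ ^ 2) < σ)) :
    ∃ C > 0, ∀ u φ : ℝ × ℝ → ℝ, SPer L₁ L₂ u → SPer L₁ L₂ φ →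
      (∫ z in Qcell L₁ L₂, u z) = 0 → (∀ x, -σ * lap2 u x - ρt * g * u x = φ x) →
      (∫ z in Qcell L₁ L₂, u z ^ 2) ≤ C * (∫ z in Qcell L₁ L₂, φ z ^ 2) ∧
      (∫ z in Qcell L₁ L₂, DD (1, 0) u z ^ 2) + (∫ z in Qcell L₁ L₂, DD (0, 1) u z ^ 2)
        ≤ C * (∫ z in Qcell L₁ L₂, φ z ^ 2) ∧
      (∫ z in Qcell L₁ L₂, DD (1, 0) (DD (1, 0) u) z ^ 2)
        + 2 * (∫ z in Qcell L₁ L₂, DD (0, 1) (DD (1, 0) u) z ^ 2)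
        + (∫ z in Qcell L₁ L₂, DD (0, 1) (DD (0, 1) u) z ^ 2)
        ≤ C * (∫ z in Qcell L₁ L₂, φ z ^ 2) := by
  set M := max (L₁ ^ 2) (L₂ ^ 2) with hM
  have hM0 : 0 < M := lt_max_of_lt_left (by positivity)
  obtain ⟨c, hc, hcoer⟩ : ∃ c > 0, ∀ F G : ℝ, 0 ≤ F → 0 ≤ G → F ≤ M * G →
      c * G ≤ σ * G - ρt * g * F := by
    rcases hcase with h | ⟨h1, h2⟩
    · refine ⟨σ, hσ, fun F G hF hG _ => ?_⟩
      have : ρt * g * F ≤ 0 :=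
        mul_nonpos_of_nonpos_of_nonneg (mul_nonpos_of_nonpos_of_nonneg h hg.le) hF
      linarith
    · refine ⟨σ - ρt * g * M, by linarith, fun F G hF hG h3 => ?_⟩
      have := mul_le_mul_of_nonneg_left h3 (mul_pos h1 hg).le
      nlinarith
  set C₁ := M / c ^ 2 with hC₁
  have hC₁p : 0 < C₁ := by positivity
  set C₂ := 2 * (1 + (ρt * g) ^ 2 * (M * C₁)) / σ ^ 2 with hC₂
  have hC₂p : 0 < C₂ := by positivity
  refine ⟨C₁ + M * C₁ + C₂, by positivity, fun u φ hu hφ h0 heq => ?_⟩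
  have cu := hu.cont
  have cφ := hφ.cont
  have cx := (hu.DD (1, 0)).cont
  have cy := (hu.DD (0, 1)).cont
  have cxx := ((hu.DD (1, 0)).DD (1, 0)).cont
  have cxy := ((hu.DD (1, 0)).DD (0, 1)).cont
  have cyy := ((hu.DD (0, 1)).DD (0, 1)).cont
  have hP := poincare hL₁ hL₂ hu h0
  rw [← hM] at hP
  have hlap : ∀ x, lap2 u x = DD (1, 0) (DD (1, 0) u) x + DD (0, 1) (DD (0, 1) u) x :=
    fun x => rfl
  have I1 : ∀ u, SPer L₁ L₂ u → (∫ z in Qcell L₁ L₂, DD (1, 0) u z) = 0 := fun u hu => hu.int1 hL₁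
  have I2 : ∀ u, SPer L₁ L₂ u → (∫ z in Qcell L₁ L₂, DD (0, 1) u z) = 0 := fun u hu => hu.int2 hL₂
  have b1 := ibp (hu.DD (1, 0)) hu (1, 0) I1
  have b2 := ibp (hu.DD (0, 1)) hu (0, 1) I2
  have b3 := ibp (hu.DD (1, 0)) ((hu.DD (0, 1)).DD (0, 1)) (1, 0) I1
  have b4 := ibp ((hu.DD (1, 0)).DD (0, 1)) (hu.DD (1, 0)) (0, 1) I2
  have e1 : DD (1, 0) (DD (0, 1) (DD (0, 1) u)) = DD (0, 1) (DD (0, 1) (DD (1, 0) u)) := by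
    rw [DD_comm (DD_smooth _ hu.smooth), DD_comm hu.smooth]
  rw [e1] at b3
  simp only [← sq] at b1 b2 b4
  have b5 : (∫ z in Qcell L₁ L₂, DD (1, 0) u z * DD (0, 1) (DD (0, 1) (DD (1, 0) u)) z)
    = ∫ z in Qcell L₁ L₂, DD (0, 1) (DD (0, 1) (DD (1, 0) u)) z * DD (1, 0) u z := by
    simp only [mul_comm]
  rw [b5, b4, neg_neg] at b3
  set F := ∫ z in Qcell L₁ L₂, u z ^ 2 with hF
  set P := ∫ z in Qcell L₁ L₂, φ z ^ 2 with hPd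
  set X := ∫ z in Qcell L₁ L₂, DD (1, 0) u z ^ 2 with hX
  set Y := ∫ z in Qcell L₁ L₂, DD (0, 1) u z ^ 2 with hY
  have hF0 : 0 ≤ F := integral_nonneg fun z => sq_nonneg _
  have hP0 : 0 ≤ P := integral_nonneg fun z => sq_nonneg _
  have hX0 : 0 ≤ X := integral_nonneg fun z => sq_nonneg _
  have hY0 : 0 ≤ Y := integral_nonneg fun z => sq_nonneg _
  have hco := hcoer F (X + Y) hF0 (by linarith) hP
  -- energy identity
  have hen : (∫ z in Qcell L₁ L₂, φ z * u z) = σ * (X + Y) - ρt * g * F := by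
    have : (∫ z in Qcell L₁ L₂, φ z * u z)
        = (-σ) * (∫ z in Qcell L₁ L₂, DD (1, 0) (DD (1, 0) u) z * u z)
          + (-σ) * (∫ z in Qcell L₁ L₂, DD (0, 1) (DD (0, 1) u) z * u z)
          + (-(ρt * g)) * ∫ z in Qcell L₁ L₂, u z ^ 2 := by
      simp only [← integral_const_mul]
      rw [← integral_add, ← integral_add]
      · congr 1
        ext z
        rw [← heq z, hlap]
        ring
      all_goals exact intQ _ _ (by fun_prop)
    rw [this, b1, b2]
    ring
  -- weighted Young
  have hyo : (∫ z in Qcell L₁ L₂, φ z * u z) ≤ (M / (2 * c)) * P + (c / (2 * M)) * F := by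
    rw [hPd, hF]
    simp only [← integral_const_mul]
    rw [← integral_add (intQ _ _ (by fun_prop)) (intQ _ _ (by fun_prop))]
    refine integral_mono (intQ _ _ (by fun_prop)) (intQ _ _ (by fun_prop)) fun z => ?_
    have : M / (2 * c) * φ z ^ 2 + c / (2 * M) * u z ^ 2 - φ z * u z
        = (M * φ z - c * u z) ^ 2 / (2 * c * M) := by
      field_simp
      ring
    have h2 : 0 ≤ (M * φ z - c * u z) ^ 2 / (2 * c * M) := by positivity
    simp only
    linarith
  have hG : X + Y ≤ C₁ * P := by
    have h1 : c / (2 * M) * F ≤ c / 2 * (X + Y) := by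
      calc c / (2 * M) * F ≤ c / (2 * M) * (M * (X + Y)) := by gcongr
        _ = c / 2 * (X + Y) := by field_simp
    have h2 : c / 2 * (X + Y) ≤ M / (2 * c) * P := by linarith
    have h3 : C₁ * P = (2 / c) * (M / (2 * c) * P) := by rw [hC₁]; field_simp
    have h4 : X + Y = (2 / c) * (c / 2 * (X + Y)) := by field_simp
    rw [h3, h4]
    gcongr
  have hFb : F ≤ M * C₁ * P := by
    calc F ≤ M * (X + Y) := hP
      _ ≤ M * (C₁ * P) := by gcongr
      _ = _ := by ring
  have t1 : 0 ≤ C₁ * P := by positivity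
  have t2 : 0 ≤ M * C₁ * P := by positivity
  have t3 : 0 ≤ C₂ * P := by positivity
  refine ⟨by linarith, by linarith, ?_⟩
  have hlapint : (∫ z in Qcell L₁ L₂, lap2 u z ^ 2)
      = (∫ z in Qcell L₁ L₂, DD (1, 0) (DD (1, 0) u) z ^ 2)
        + 2 * (∫ z in Qcell L₁ L₂, DD (1, 0) (DD (1, 0) u) z * DD (0, 1) (DD (0, 1) u) z)
        + (∫ z in Qcell L₁ L₂, DD (0, 1) (DD (0, 1) u) z ^ 2) := by
    simp only [← integral_const_mul]
    rw [← integral_add, ← integral_add]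
    · congr 1
      ext z
      rw [hlap]
      ring
    all_goals exact intQ _ _ (by fun_prop)
  have hlapb : (∫ z in Qcell L₁ L₂, lap2 u z ^ 2) ≤ (2 / σ ^ 2) * P
      + (2 * (ρt * g) ^ 2 / σ ^ 2) * F := by
    rw [hPd, hF]
    simp only [← integral_const_mul]
    rw [← integral_add (intQ _ _ (by fun_prop)) (intQ _ _ (by fun_prop))]
    refine integral_mono (intQ _ _ (by simp only [hlap]; fun_prop))
      (intQ _ _ (by fun_prop)) fun z => ?_
    have h1 : lap2 u z = -(φ z + ρt * g * u z) / σ := by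
      rw [← heq z]
      field_simp
      ring
    have : 2 / σ ^ 2 * φ z ^ 2 + 2 * (ρt * g) ^ 2 / σ ^ 2 * u z ^ 2 - lap2 u z ^ 2
        = (φ z - ρt * g * u z) ^ 2 / σ ^ 2 := by
      rw [h1]
      field_simp
      ring
    have h2 : 0 ≤ (φ z - ρt * g * u z) ^ 2 / σ ^ 2 := by positivity
    simp only
    linarith
  rw [hlapint, b3] at hlapb
  have h5 : (2 * (ρt * g) ^ 2 / σ ^ 2) * F ≤ (2 * (ρt * g) ^ 2 / σ ^ 2) * (M * C₁ * P) := by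
    gcongr
  have h6 : C₂ * P = (2 / σ ^ 2) * P + (2 * (ρt * g) ^ 2 / σ ^ 2) * (M * C₁ * P) := by
    rw [hC₂]
    field_simp
  rw [add_mul, add_mul]
  linarith

/-! ### Iterated derivatives -/

theorem itd_up {u : ℝ × ℝ → ℝ} (hu : ContDiff ℝ (⊤ : ℕ∞) u) (k : ℕ) (x : ℝ × ℝ) :
    ‖iteratedFDeriv ℝ (k + 1) u x‖
      ≤ ‖iteratedFDeriv ℝ k (DD (1, 0) u) x‖ + ‖iteratedFDeriv ℝ k (DD (0, 1) u) x‖ := by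
  rw [← norm_iteratedFDeriv_fderiv]
  set A := ContinuousLinearMap.toSpanSingleton ℝ (ContinuousLinearMap.fst ℝ ℝ ℝ) with hA
  set B := ContinuousLinearMap.toSpanSingleton ℝ (ContinuousLinearMap.snd ℝ ℝ ℝ) with hB
  have nA : ‖A‖ ≤ 1 := by
    rw [hA, ContinuousLinearMap.norm_toSpanSingleton]
    exact ContinuousLinearMap.norm_fst_le ℝ ℝ ℝ
  have nB : ‖B‖ ≤ 1 := by
    rw [hB, ContinuousLinearMap.norm_toSpanSingleton]
    exact ContinuousLinearMap.norm_snd_le ℝ ℝ ℝ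
  have h1 := DD_smooth (1, 0) hu
  have h2 := DD_smooth (0, 1) hu
  have e : fderiv ℝ u = (A ∘ DD (1, 0) u) + (B ∘ DD (0, 1) u) := by
    funext y
    ext <;> simp [hA, hB, DD]
  have hk : ((k : ℕ) : WithTop ℕ∞) ≤ ((⊤ : ℕ∞) : WithTop ℕ∞) := by exact_mod_cast le_top
  have d1 : ContDiffAt ℝ k (A ∘ DD (1, 0) u) x := ((A.contDiff.comp h1).of_le hk).contDiffAt
  have d2 : ContDiffAt ℝ k (B ∘ DD (0, 1) u) x := ((B.contDiff.comp h2).of_le hk).contDiffAt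
  rw [e, iteratedFDeriv_add_apply d1 d2]
  refine (norm_add_le _ _).trans (add_le_add ?_ ?_)
  · refine (A.norm_iteratedFDeriv_comp_left h1.contDiffAt hk).trans ?_
    exact mul_le_of_le_one_left (norm_nonneg _) nA
  · refine (B.norm_iteratedFDeriv_comp_left h2.contDiffAt hk).trans ?_
    exact mul_le_of_le_one_left (norm_nonneg _) nB

theorem itd_down {u : ℝ × ℝ → ℝ} (hu : ContDiff ℝ (⊤ : ℕ∞) u) (k : ℕ) (v : ℝ × ℝ)
    (hv : ‖v‖ ≤ 1) (x : ℝ × ℝ) :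
    ‖iteratedFDeriv ℝ k (DD v u) x‖ ≤ ‖iteratedFDeriv ℝ (k + 1) u x‖ := by
  rw [← norm_iteratedFDeriv_fderiv]
  have hk : ((k : ℕ) : WithTop ℕ∞) ≤ ((⊤ : ℕ∞) : WithTop ℕ∞) := by exact_mod_cast le_top
  have h1 : ContDiff ℝ (⊤ : ℕ∞) (fderiv ℝ u) :=
    hu.fderiv_right (m := (⊤ : ℕ∞)) (by exact_mod_cast le_rfl)
  have e : DD v u = (ContinuousLinearMap.apply ℝ ℝ v) ∘ (fderiv ℝ u) := by
    funext y
    simp [DD]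
  have n : ‖ContinuousLinearMap.apply ℝ ℝ v‖ ≤ 1 := by
    refine ContinuousLinearMap.opNorm_le_bound _ zero_le_one fun L => ?_
    rw [one_mul, ContinuousLinearMap.apply_apply]
    exact (L.le_opNorm v).trans (mul_le_of_le_one_right (norm_nonneg _) hv)
  rw [e]
  refine ((ContinuousLinearMap.apply ℝ ℝ v).norm_iteratedFDeriv_comp_left
    h1.contDiffAt hk).trans ?_
  exact mul_le_of_le_one_left (norm_nonneg _) n

theorem itd_cont {u : ℝ × ℝ → ℝ} (hu : ContDiff ℝ (⊤ : ℕ∞) u) (k : ℕ) :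
    Continuous (fun x => ‖iteratedFDeriv ℝ k u x‖ ^ 2) :=
  ((hu.continuous_iteratedFDeriv (m := k) (by exact_mod_cast le_top)).norm).pow 2

theorem int_up (L₁ L₂ : ℝ) {u : ℝ × ℝ → ℝ} (hu : ContDiff ℝ (⊤ : ℕ∞) u) (k : ℕ) :
    (∫ x in Qcell L₁ L₂, ‖iteratedFDeriv ℝ (k + 1) u x‖ ^ 2)
      ≤ 2 * ((∫ x in Qcell L₁ L₂, ‖iteratedFDeriv ℝ k (DD (1, 0) u) x‖ ^ 2)
        + ∫ x in Qcell L₁ L₂, ‖iteratedFDeriv ℝ k (DD (0, 1) u) x‖ ^ 2) := by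
  have h1 := itd_cont (DD_smooth (1, 0) hu) k
  have h2 := itd_cont (DD_smooth (0, 1) hu) k
  rw [← integral_add (intQ _ _ h1) (intQ _ _ h2), ← integral_const_mul]
  refine integral_mono (intQ _ _ (itd_cont hu _)) (intQ _ _ (by fun_prop)) fun x => ?_
  have h := itd_up hu k x
  have h0 := norm_nonneg (iteratedFDeriv ℝ (k + 1) u x)
  simp only
  have := pow_le_pow_left₀ h0 h 2
  nlinarith [sq_nonneg (‖iteratedFDeriv ℝ k (DD (1, 0) u) x‖
    - ‖iteratedFDeriv ℝ k (DD (0, 1) u) x‖)]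

theorem int_down (L₁ L₂ : ℝ) {u : ℝ × ℝ → ℝ} (hu : ContDiff ℝ (⊤ : ℕ∞) u) (k : ℕ) (v : ℝ × ℝ)
    (hv : ‖v‖ ≤ 1) :
    (∫ x in Qcell L₁ L₂, ‖iteratedFDeriv ℝ k (DD v u) x‖ ^ 2)
      ≤ ∫ x in Qcell L₁ L₂, ‖iteratedFDeriv ℝ (k + 1) u x‖ ^ 2 := by
  refine integral_mono (intQ _ _ (itd_cont (DD_smooth v hu) _)) (intQ _ _ (itd_cont hu _))
    fun x => ?_
  exact pow_le_pow_left₀ (norm_nonneg _) (itd_down hu k v hv x) 2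

theorem int_zero (L₁ L₂ : ℝ) (u : ℝ × ℝ → ℝ) :
    (∫ x in Qcell L₁ L₂, ‖iteratedFDeriv ℝ 0 u x‖ ^ 2) = ∫ x in Qcell L₁ L₂, u x ^ 2 := by
  simp [norm_iteratedFDeriv_zero]

theorem eq_DD {L₁ L₂ : ℝ} (g σ ρt : ℝ) {u φ : ℝ × ℝ → ℝ} (hu : SPer L₁ L₂ u)
    (heq : ∀ x, -σ * lap2 u x - ρt * g * u x = φ x) (v : ℝ × ℝ) (x : ℝ × ℝ) :
    -σ * lap2 (DD v u) x - ρt * g * DD v u x = DD v φ x := by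
  have hφ : φ = fun x => -σ * (DD (1, 0) (DD (1, 0) u) x + DD (0, 1) (DD (0, 1) u) x)
      - ρt * g * u x := by
    funext y
    rw [← heq y]
    rfl
  have d1 := ((hu.DD (1, 0)).DD (1, 0)).diff x
  have d2 := ((hu.DD (0, 1)).DD (0, 1)).diff x
  have d3 := hu.diff x
  have e1 : DD (1, 0) (DD (1, 0) (DD v u)) = DD v (DD (1, 0) (DD (1, 0) u)) := by
    rw [DD_comm hu.smooth (1, 0) v, DD_comm (DD_smooth _ hu.smooth) (1, 0) v]
  have e2 : DD (0, 1) (DD (0, 1) (DD v u)) = DD v (DD (0, 1) (DD (0, 1) u)) := by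
    rw [DD_comm hu.smooth (0, 1) v, DD_comm (DD_smooth _ hu.smooth) (0, 1) v]
  have hl : lap2 (DD v u) x = DD (1, 0) (DD (1, 0) (DD v u)) x
      + DD (0, 1) (DD (0, 1) (DD v u)) x := rfl
  rw [hl, e1, e2]
  have hd : HasFDerivAt φ (-σ • (fderiv ℝ (DD (1, 0) (DD (1, 0) u)) x
      + fderiv ℝ (DD (0, 1) (DD (0, 1) u)) x) - (ρt * g) • fderiv ℝ u x) x := by
    rw [hφ]
    exact ((d1.hasFDerivAt.add d2.hasFDerivAt).const_mul (-σ)).sub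
      (d3.hasFDerivAt.const_mul (ρt * g))
  have : DD v φ x = fderiv ℝ φ x v := rfl
  rw [this, hd.fderiv]
  simp [DD]
  ring

theorem high_est {L₁ L₂ : ℝ} (hL₁ : 0 < L₁) (hL₂ : 0 < L₂)
    (g σ ρt : ℝ) (hg : 0 < g) (hσ : 0 < σ)
    (hcase : ρt ≤ 0 ∨ (0 < ρt ∧ ρt * g * max (L₁ ^ 2) (L₂ ^ 2) < σ)) (k : ℕ) :
    ∃ C > 0, ∀ u φ : ℝ × ℝ → ℝ, SPer L₁ L₂ u → SPer L₁ L₂ φ →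
      (∫ z in Qcell L₁ L₂, u z) = 0 → (∀ x, -σ * lap2 u x - ρt * g * u x = φ x) →
      (∫ x in Qcell L₁ L₂, ‖iteratedFDeriv ℝ (k + 2) u x‖ ^ 2)
        ≤ C * ∫ x in Qcell L₁ L₂, ‖iteratedFDeriv ℝ k φ x‖ ^ 2 := by
  induction k with
  | zero =>
    obtain ⟨C, hC, h⟩ := h2_est hL₁ hL₂ g σ ρt hg hσ hcase
    refine ⟨4 * C, by positivity, fun u φ hu hφ h0 heq => ?_⟩
    obtain ⟨-, -, h3⟩ := h u φ hu hφ h0 heq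
    have a := int_up L₁ L₂ hu.smooth 1
    have b := int_up L₁ L₂ (hu.DD (1, 0)).smooth 0
    have c := int_up L₁ L₂ (hu.DD (0, 1)).smooth 0
    simp only [int_zero] at a b c ⊢
    rw [DD_comm hu.smooth (1, 0) (0, 1)] at c
    linarith
  | succ k ih =>
    obtain ⟨C, hC, h⟩ := ih
    refine ⟨4 * C, by positivity, fun u φ hu hφ h0 heq => ?_⟩
    have a := int_up L₁ L₂ hu.smooth (k + 2)
    have b := h _ _ (hu.DD (1, 0)) (hφ.DD (1, 0)) (hu.int1 hL₁) (eq_DD g σ ρt hu heq _)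
    have c := h _ _ (hu.DD (0, 1)) (hφ.DD (0, 1)) (hu.int2 hL₂) (eq_DD g σ ρt hu heq _)
    have d := mul_le_mul_of_nonneg_left (int_down L₁ L₂ hφ.smooth k (1, 0) (by simp)) hC.le
    have e := mul_le_mul_of_nonneg_left (int_down L₁ L₂ hφ.smooth k (0, 1) (by simp)) hC.le
    have : k + 1 + 2 = k + 2 + 1 := by ring
    rw [this]
    linarith

/-- `H^r` elliptic estimate for `−σΔf − ρ̃gf = φ` above the critical surface tension:
for every integer `r ≥ 2` there is `C > 0` (depending only on `r, σ, ρ̃, g, L₁, L₂`) with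
`Σ_{k=0}^{r} ∫_Q ‖D^k f‖² ≤ C Σ_{k=0}^{r−2} ∫_Q ‖D^k φ‖²` for all smooth horizontally
periodic zero-average solutions. -/
theorem stmt_4 (L₁ L₂ : ℝ) (hL₁ : 0 < L₁) (hL₂ : 0 < L₂)
    (g σ ρt : ℝ) (hg : 0 < g) (hσ : 0 < σ)
    (hcase : ρt ≤ 0 ∨ (0 < ρt ∧ ρt * g * max (L₁ ^ 2) (L₂ ^ 2) < σ))
    (r : ℕ) (hr : 2 ≤ r) :
    ∃ C > 0, ∀ f φ : ℝ × ℝ → ℝ, ContDiff ℝ (⊤ : ℕ∞) f → ContDiff ℝ (⊤ : ℕ∞) φ →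
      (∀ x₁ x₂ : ℝ, f (x₁ + 2 * Real.pi * L₁, x₂) = f (x₁, x₂)) →
      (∀ x₁ x₂ : ℝ, f (x₁, x₂ + 2 * Real.pi * L₂) = f (x₁, x₂)) →
      (∀ x₁ x₂ : ℝ, φ (x₁ + 2 * Real.pi * L₁, x₂) = φ (x₁, x₂)) →
      (∀ x₁ x₂ : ℝ, φ (x₁, x₂ + 2 * Real.pi * L₂) = φ (x₁, x₂)) →
      (∫ x in Qcell L₁ L₂, f x) = 0 →
      (∀ x : ℝ × ℝ, -σ * lap2 f x - ρt * g * f x = φ x) →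
      (∑ k ∈ Finset.range (r + 1), ∫ x in Qcell L₁ L₂, ‖iteratedFDeriv ℝ k f x‖ ^ 2)
        ≤ C * ∑ k ∈ Finset.range (r - 1), ∫ x in Qcell L₁ L₂, ‖iteratedFDeriv ℝ k φ x‖ ^ 2 := by

  choose C hC hest using high_est hL₁ hL₂ g σ ρt hg hσ hcase
  obtain ⟨C₀, hC₀, hlow⟩ := h2_est hL₁ hL₂ g σ ρt hg hσ hcase
  have hS : 0 ≤ ∑ k ∈ Finset.range (r - 1), C k := Finset.sum_nonneg fun k _ => (hC k).le
  refine ⟨3 * C₀ + ∑ k ∈ Finset.range (r - 1), C k, by positivity, ?_⟩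
  intro f φ hf hφ f1 f2 p1 p2 h0 heq
  have sf : SPer L₁ L₂ f := ⟨hf, f1, f2⟩
  have sp : SPer L₁ L₂ φ := ⟨hφ, p1, p2⟩
  obtain ⟨l1, l2, -⟩ := hlow f φ sf sp h0 heq
  have hup := int_up L₁ L₂ hf 0
  simp only [int_zero] at hup
  obtain ⟨m, rfl⟩ : ∃ m, r = m + 2 := ⟨r - 2, by omega⟩
  have hm : m + 2 - 1 = m + 1 := by omega
  rw [hm]
  have hnn : ∀ k, 0 ≤ ∫ x in Qcell L₁ L₂, ‖iteratedFDeriv ℝ k φ x‖ ^ 2 :=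
    fun k => integral_nonneg fun x => sq_nonneg _
  have hle : ∀ k ∈ Finset.range (m + 1), (∫ x in Qcell L₁ L₂, ‖iteratedFDeriv ℝ k φ x‖ ^ 2)
      ≤ ∑ k ∈ Finset.range (m + 1), ∫ x in Qcell L₁ L₂, ‖iteratedFDeriv ℝ k φ x‖ ^ 2 :=
    fun k hk => Finset.single_le_sum (fun k _ => hnn k) hk
  have hle0 := hle 0 (by simp)
  rw [int_zero] at hle0
  set S := ∑ k ∈ Finset.range (m + 1), ∫ x in Qcell L₁ L₂, ‖iteratedFDeriv ℝ k φ x‖ ^ 2 with hSd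
  rw [show m + 2 + 1 = (m + 1) + 1 + 1 by ring, Finset.sum_range_succ', Finset.sum_range_succ',
    int_zero]
  have hsum : (∑ k ∈ Finset.range (m + 1),
      ∫ x in Qcell L₁ L₂, ‖iteratedFDeriv ℝ (k + 1 + 1) f x‖ ^ 2)
      ≤ (∑ k ∈ Finset.range (m + 1), C k) * S := by
    rw [Finset.sum_mul]
    refine Finset.sum_le_sum fun k hk => ?_
    exact (hest k f φ sf sp h0 heq).trans (mul_le_mul_of_nonneg_left (hle k hk) (hC k).le)
  have := mul_le_mul_of_nonneg_left hle0 hC₀.le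
  rw [add_mul]
  linarith
end

section
/- Korn's inequality: there exists a constant C > 0, depending only on L₁, L₂ and b, such that for every C¹ horizontally periodic vector field u : ℝ³ → ℝ³ with u(x₁, x₂, −b(x₁,x₂)) = 0 for all (x₁,x₂), one has ∫_{Ω ∩ (Q × ℝ)} ( |u(x)|² + ‖∇u(x)‖² ) dx ≤ C ∫_{Ω ∩ (Q × ℝ)} |𝔻u(x)|² dx. -/
open MeasureTheory

/-- Partial derivative `∂ᵢ f` of a scalar function on `ℝ³ = Fin 3 → ℝ`. -/
noncomputable def pd3 (i : Fin 3) (f : (Fin 3 → ℝ) → ℝ) (x : Fin 3 → ℝ) : ℝ :=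
  fderiv ℝ f x (Pi.single i 1)

/-- One periodic cell of the two-fluid domain `Ω = {−b(x₁,x₂) < x₃ < 1}`,
i.e. `Ω ∩ (Q × ℝ)`. -/
def omegaCell (L₁ L₂ : ℝ) (b : ℝ × ℝ → ℝ) : Set (Fin 3 → ℝ) :=
  {x | x 0 ∈ Set.Icc 0 (2 * Real.pi * L₁) ∧ x 1 ∈ Set.Icc 0 (2 * Real.pi * L₂) ∧
    -b (x 0, x 1) < x 2 ∧ x 2 < 1}


/-- The horizontal periodicity box, as a family of sets. -/
def kbx (P Q : ℝ) : Fin 3 → Set ℝ := ![Set.Ioc 0 P, Set.Ioc 0 Q, Set.univ]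

/-- The one-dimensional factors of the measure on a periodicity cell. -/
noncomputable def knu (P Q : ℝ) (i : Fin 3) : Measure ℝ := volume.restrict (kbx P Q i)

instance (P Q : ℝ) (i : Fin 3) : SigmaFinite (knu P Q i) := by
  unfold knu; infer_instance

/-- Lebesgue measure on the periodicity cell. -/
noncomputable def kmu (P Q : ℝ) : Measure (Fin 3 → ℝ) := Measure.pi (knu P Q)

lemma kmu_eq (P Q : ℝ) : kmu P Q = volume.restrict (Set.univ.pi (kbx P Q)) := by
  unfold kmu
  rw [volume_pi, Measure.restrict_pi_pi]; rfl

lemma knu_two (P Q : ℝ) : knu P Q 2 = volume := by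
  simp [knu, kbx]

lemma kmu_fub (P Q : ℝ) (i : Fin 3) (H : (Fin 3 → ℝ) → ℝ) (hH : Integrable H (kmu P Q)) :
    ∫ x, H x ∂(kmu P Q) = ∫ y, ∫ t, H (i.insertNth t y) ∂(knu P Q i)
      ∂(Measure.pi (fun j => knu P Q (i.succAbove j))) := by
  have mp := (measurePreserving_piFinSuccAbove (knu P Q) i).symm
  have h1 := mp.integral_comp' (g := H)
  have h2 : Integrable (fun z => H ((MeasurableEquiv.piFinSuccAbove (fun _ => ℝ) i).symm z))
      ((knu P Q i).prod (Measure.pi (fun j => knu P Q (i.succAbove j)))) :=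
    (mp.integrable_comp_emb (MeasurableEquiv.measurableEmbedding _)).2 hH
  have h3 := integral_prod_symm _ h2
  rw [kmu, ← h1, h3]
  rfl

/-- One-coordinate change of variables. -/
lemma kmu_cov (P Q : ℝ) (i : Fin 3) (T : ℝ → ℝ) (c : ℝ) (H : (Fin 3 → ℝ) → ℝ)
    (hH : Integrable H (kmu P Q))
    (hH2 : Integrable (fun x => H (Function.update x i (T (x i)))) (kmu P Q))
    (h1 : ∀ y, ∫ t, H (i.insertNth (T t) y) ∂(knu P Q i)
      = c * ∫ t, H (i.insertNth t y) ∂(knu P Q i)) :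
    ∫ x, H (Function.update x i (T (x i))) ∂(kmu P Q) = c * ∫ x, H x ∂(kmu P Q) := by
  rw [kmu_fub P Q i _ hH, kmu_fub P Q i _ hH2, ← integral_const_mul]
  congr 1; ext y
  rw [← h1]
  congr 1; ext t
  simp

lemma kmu_integrable (P Q M K : ℝ) (H : (Fin 3 → ℝ) → ℝ) (hm : AEStronglyMeasurable H (kmu P Q))
    (hK : ∀ x, |H x| ≤ K) (hM : ∀ x, M < |x 2| → H x = 0) : Integrable H (kmu P Q) := by
  have hs : MeasurableSet {x : Fin 3 → ℝ | |x 2| ≤ M} :=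
    measurableSet_le (by fun_prop) (by fun_prop)
  have hfin : kmu P Q {x : Fin 3 → ℝ | |x 2| ≤ M} < ⊤ := by
    have h1 : {x : Fin 3 → ℝ | |x 2| ≤ M} = Set.univ.pi ![Set.univ, Set.univ, Set.Icc (-M) M] := by
      ext x
      simp [Set.mem_pi, Fin.forall_fin_succ, abs_le]
    rw [h1, kmu, Measure.pi_pi]
    apply ENNReal.prod_lt_top
    intro i _
    fin_cases i <;> simp [knu, kbx]
  have h2 : Integrable ({x : Fin 3 → ℝ | |x 2| ≤ M}.indicator (fun _ => K)) (kmu P Q) :=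
    (integrable_indicator_iff hs).2 (integrableOn_const hfin.ne)
  refine h2.mono' hm (Filter.Eventually.of_forall fun x => ?_)
  by_cases hx : |x 2| ≤ M
  · simpa [Set.indicator, hx] using hK x
  · simp [Set.indicator, hx, hM x (not_le.1 hx)]

/-- Translation invariance. -/
lemma kmu_shift (P Q : ℝ) (hP : 0 < P) (hQ : 0 < Q) (i : Fin 3) (s : ℝ) (H : (Fin 3 → ℝ) → ℝ)
    (hp0 : ∀ x, H (x + P • (Pi.single 0 1 : Fin 3 → ℝ)) = H x)
    (hp1 : ∀ x, H (x + Q • (Pi.single 1 1 : Fin 3 → ℝ)) = H x)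
    (hH : Integrable H (kmu P Q))
    (hH2 : Integrable (fun x => H (x + s • Pi.single i 1)) (kmu P Q)) :
    ∫ x, H (x + s • Pi.single i 1) ∂(kmu P Q) = ∫ x, H x ∂(kmu P Q) := by
  have e : ∀ x : Fin 3 → ℝ, x + s • Pi.single i 1 = Function.update x i (x i + s) := by
    intro x; ext j
    by_cases h : j = i
    · subst h; simp
    · simp [h]
  simp only [e] at hH2 ⊢
  rw [kmu_cov P Q i (fun t => t + s) 1 H hH hH2, one_mul]
  intro y
  rw [one_mul]
  have key : ∀ R : ℝ, 0 < R → (∀ x, H (x + R • (Pi.single i 1 : Fin 3 → ℝ)) = H x) →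
      ∫ t in Set.Ioc 0 R, H (i.insertNth (t + s) y) = ∫ t in Set.Ioc 0 R, H (i.insertNth t y) := by
    intro R hR hper
    have hp : Function.Periodic (fun t => H (i.insertNth t y)) R := by
      intro t
      change H _ = H _
      rw [← hper (i.insertNth t y)]
      congr 1; ext j
      by_cases h : j = i
      · subst h; simp
      · obtain ⟨k, rfl⟩ := Fin.exists_succAbove_eq h
        simp
    have := hp.intervalIntegral_add_eq s 0
    rw [zero_add] at this
    rw [← intervalIntegral.integral_of_le hR.le, ← intervalIntegral.integral_of_le hR.le, ← this,
      intervalIntegral.integral_comp_add_right (fun t => H (i.insertNth t y)) s]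
    simp [add_comm]
  fin_cases i
  · exact key P hP hp0
  · exact key Q hQ hp1
  · simp only [Fin.reduceFinMk, knu_two]
    exact integral_add_right_eq_self (fun t => H ((2 : Fin 3).insertNth t y)) s

/-- graphs are null sets -/
lemma kmu_graph (P Q : ℝ) (g : ℝ × ℝ → ℝ) (hg : Continuous g) :
    ∀ᵐ x ∂(kmu P Q), x 2 ≠ g (x 0, x 1) := by
  have mp := (measurePreserving_piFinSuccAbove (knu P Q) 2)
  have hms : MeasurableSet {z : ℝ × (Fin 2 → ℝ) | z.1 = g (z.2 0, z.2 1)} :=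
    measurableSet_eq_fun (by fun_prop) (by fun_prop)
  have : ∀ᵐ z ∂((knu P Q 2).prod (Measure.pi (fun j => knu P Q ((2 : Fin 3).succAbove j)))),
      z.1 ≠ g (z.2 0, z.2 1) := by
    rw [ae_iff]
    simp only [ne_eq, not_not]
    rw [Measure.prod_apply_symm hms]
    have : ∀ y : Fin 2 → ℝ, knu P Q 2 ((fun x => (x, y)) ⁻¹'
        {z : ℝ × (Fin 2 → ℝ) | z.1 = g (z.2 0, z.2 1)}) = 0 := by
      intro y
      rw [knu_two]
      have : ((fun x => (x, y)) ⁻¹' {z : ℝ × (Fin 2 → ℝ) | z.1 = g (z.2 0, z.2 1)})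
        = {g (y 0, y 1)} := by ext; simp
      rw [this]; simp
    simp only [this, lintegral_zero]
  have h := mp.quasiMeasurePreserving.ae this
  exact h

/-- Lipschitz, horizontally periodic functions with vertically bounded support. -/
structure KGood (P Q M : ℝ) (K : NNReal) (f : (Fin 3 → ℝ) → ℝ) : Prop where
  lip : LipschitzWith K f
  per0 : ∀ x, f (x + P • (Pi.single 0 1 : Fin 3 → ℝ)) = f x
  per1 : ∀ x, f (x + Q • (Pi.single 1 1 : Fin 3 → ℝ)) = f x
  supp : ∀ x, M < |x 2| → f x = 0

/-- line derivative in a coordinate direction -/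
noncomputable def kld (f : (Fin 3 → ℝ) → ℝ) (i : Fin 3) (x : Fin 3 → ℝ) : ℝ :=
  lineDeriv ℝ f x (Pi.single i 1)

lemma knorm_single (i : Fin 3) : ‖(Pi.single i 1 : Fin 3 → ℝ)‖ = 1 := by
  rw [Pi.norm_single, norm_one]

lemma KGood.diff {P Q M : ℝ} {K : NNReal} {f : (Fin 3 → ℝ) → ℝ} (hf : KGood P Q M K f)
    (i : Fin 3) (t : ℝ) (x : Fin 3 → ℝ) : |f (x + t • Pi.single i 1) - f x| ≤ K * |t| := by
  have := hf.lip.dist_le_mul (x + t • Pi.single i 1) x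
  simpa [Real.dist_eq, dist_eq_norm, norm_smul, knorm_single] using this

lemma KGood.bdd {P Q M : ℝ} {K : NNReal} {f : (Fin 3 → ℝ) → ℝ} (hf : KGood P Q M K f)
    (x : Fin 3 → ℝ) : |f x| ≤ K * |2 * M + 1| := by
  by_cases hx : M < |x 2|
  · rw [hf.supp x hx]; simp; positivity
  · have h := hf.diff 2 (2 * M + 1) x
    rw [hf.supp (x + (2 * M + 1) • Pi.single 2 1)] at h
    · simpa using h
    · have := abs_le.1 (not_lt.1 hx)
      simp
      exact lt_of_lt_of_le (by linarith) (le_abs_self _)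

lemma KGood.kld_bdd {P Q M : ℝ} {K : NNReal} {f : (Fin 3 → ℝ) → ℝ} (hf : KGood P Q M K f)
    (i : Fin 3) (x : Fin 3 → ℝ) : |kld f i x| ≤ K := by
  have := norm_lineDeriv_le_of_lipschitz ℝ (x₀ := x) (v := Pi.single i 1) hf.lip
  simpa [kld, knorm_single] using this

lemma KGood.kld_supp {P Q M : ℝ} {K : NNReal} {f : (Fin 3 → ℝ) → ℝ} (hf : KGood P Q M K f)
    (i : Fin 3) (x : Fin 3 → ℝ) (hx : M < |x 2|) : kld f i x = 0 := by
  have h : f =ᶠ[nhds x] fun _ => 0 := by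
    have : ∀ᶠ y in nhds x, M < |y 2| :=
      (continuous_const.continuousAt).eventually_lt
        ((continuous_apply 2).abs.continuousAt) hx
    filter_upwards [this] with y hy using hf.supp y hy
  rw [kld, h.lineDeriv_eq]
  simp [lineDeriv]

lemma KGood.kld_meas {P Q M : ℝ} {K : NNReal} {f : (Fin 3 → ℝ) → ℝ} (hf : KGood P Q M K f)
    (i : Fin 3) : Measurable (kld f i) :=
  measurable_lineDeriv hf.lip.continuous

lemma KGood.kld_ae {P Q M : ℝ} {K : NNReal} {f : (Fin 3 → ℝ) → ℝ} (hf : KGood P Q M K f)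
    (i : Fin 3) : ∀ᵐ x ∂(kmu P Q), HasLineDerivAt ℝ f (kld f i x) x (Pi.single i 1) := by
  rw [kmu_eq]
  apply ae_restrict_of_ae
  filter_upwards [hf.lip.ae_lineDifferentiableAt (μ := volume) (Pi.single i 1)] with x hx
  exact hx.hasLineDerivAt

/-- difference quotient -/
noncomputable def kdq (f : (Fin 3 → ℝ) → ℝ) (i : Fin 3) (t : ℝ) (x : Fin 3 → ℝ) : ℝ :=
  t⁻¹ * (f (x + t • Pi.single i 1) - f x)

lemma KGood.kdq_bdd {P Q M : ℝ} {K : NNReal} {f : (Fin 3 → ℝ) → ℝ} (hf : KGood P Q M K f)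
    (i : Fin 3) (t : ℝ) (x : Fin 3 → ℝ) : |kdq f i t x| ≤ K := by
  rw [kdq, abs_mul, abs_inv]
  rcases eq_or_ne t 0 with rfl | ht
  · simp
  · rw [inv_mul_le_iff₀ (abs_pos.2 ht), mul_comm]
    exact hf.diff i t x

lemma abs_shift_two (x : Fin 3 → ℝ) (i : Fin 3) (t M : ℝ) (hx : M + |t| < |x 2|) :
    M < |(x + t • (Pi.single i 1 : Fin 3 → ℝ)) 2| := by
  have h1 : |t * (Pi.single i 1 : Fin 3 → ℝ) 2| ≤ |t| := by
    rw [abs_mul]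
    have : |(Pi.single i 1 : Fin 3 → ℝ) 2| ≤ 1 := by
      fin_cases i <;> simp
    nlinarith [abs_nonneg t]
  have h2 := abs_sub_abs_le_abs_sub (x 2) (-(t * (Pi.single i 1 : Fin 3 → ℝ) 2))
  simp only [Pi.add_apply, Pi.smul_apply, smul_eq_mul]
  rw [abs_neg, sub_neg_eq_add] at h2
  linarith

lemma KGood.kdq_supp {P Q M : ℝ} {K : NNReal} {f : (Fin 3 → ℝ) → ℝ} (hf : KGood P Q M K f)
    (i : Fin 3) (t : ℝ) (x : Fin 3 → ℝ) (hx : M + |t| < |x 2|) : kdq f i t x = 0 := by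
  rw [kdq, hf.supp x (by linarith [abs_nonneg t]), hf.supp _ (abs_shift_two x i t M hx)]
  simp

lemma KGood.kdq_cont {P Q M : ℝ} {K : NNReal} {f : (Fin 3 → ℝ) → ℝ} (hf : KGood P Q M K f)
    (i : Fin 3) (t : ℝ) : Continuous (kdq f i t) := by
  have := hf.lip.continuous
  unfold kdq
  fun_prop

lemma kint_const (P Q M K : ℝ) :
    Integrable ({x : Fin 3 → ℝ | |x 2| ≤ M}.indicator (fun _ => K)) (kmu P Q) := by
  have hs : MeasurableSet {x : Fin 3 → ℝ | |x 2| ≤ M} :=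
    measurableSet_le (by fun_prop) (by fun_prop)
  refine kmu_integrable P Q M |K| _ ((measurable_const.indicator hs).aestronglyMeasurable) ?_ ?_
  · intro x
    by_cases hx : |x 2| ≤ M <;> simp [Set.indicator, hx]
  · intro x hx
    simp [Set.indicator, not_le.2 hx]

lemma KGood.lim {P Q M : ℝ} {K K' : NNReal} {f g : (Fin 3 → ℝ) → ℝ} (hf : KGood P Q M K f)
    (hg : KGood P Q M K' g) (i j : Fin 3) :
    Filter.Tendsto (fun t => ∫ x, kdq f i t x * kdq g j t x ∂(kmu P Q)) (nhdsWithin 0 {0}ᶜ)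
      (nhds (∫ x, kld f i x * kld g j x ∂(kmu P Q))) := by
  have hsmall : ∀ᶠ t : ℝ in nhdsWithin 0 {0}ᶜ, |t| < 1 := by
    apply eventually_nhdsWithin_of_eventually_nhds
    exact (continuous_abs.continuousAt).eventually_lt continuous_const.continuousAt (by simp)
  refine tendsto_integral_filter_of_dominated_convergence
    ({x : Fin 3 → ℝ | |x 2| ≤ M + 1}.indicator (fun _ => (K : ℝ) * K')) ?_ ?_ (kint_const _ _ _ _) ?_
  · refine Filter.Eventually.of_forall fun t => ?_
    exact ((hf.kdq_cont i t).mul (hg.kdq_cont j t)).aestronglyMeasurable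
  · filter_upwards [hsmall] with t ht
    refine Filter.Eventually.of_forall fun x => ?_
    by_cases hx : |x 2| ≤ M + 1
    · simp only [Set.indicator, Set.mem_ofPred_eq, hx, if_true, norm_mul, Real.norm_eq_abs]
      exact mul_le_mul (hf.kdq_bdd i t x) (hg.kdq_bdd j t x) (abs_nonneg _) (by positivity)
    · rw [hf.kdq_supp i t x (by linarith)]
      simp [Set.indicator, hx]
  · filter_upwards [hf.kld_ae i, hg.kld_ae j] with x h1 h2
    exact h1.tendsto_slope_zero.mul h2.tendsto_slope_zero

lemma KGood.disc {P Q M : ℝ} {K K' : NNReal} {f g : (Fin 3 → ℝ) → ℝ} (hP : 0 < P) (hQ : 0 < Q)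
    (hf : KGood P Q M K f) (hg : KGood P Q M K' g) (i j : Fin 3) (t : ℝ) :
    ∫ x, kdq f i t x * kdq g j t x ∂(kmu P Q)
      = ∫ x, kdq f j (-t) x * kdq g i (-t) x ∂(kmu P Q) := by
  have cf := hf.lip.continuous
  have cg := hg.lip.continuous
  have prod_int : ∀ v w : Fin 3 → ℝ, (|v 2| ≤ 2 * |t|) →
      Integrable (fun x => f (x + v) * g (x + w)) (kmu P Q) := by
    intro v w hv
    refine kmu_integrable P Q (M + 2 * |t|) (K * |2 * M + 1| * (K' * |2 * M + 1|)) _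
      (by fun_prop) ?_ ?_
    · intro x
      rw [abs_mul]
      exact mul_le_mul (hf.bdd _) (hg.bdd _) (abs_nonneg _) (by positivity)
    · intro x hx
      rw [hf.supp, zero_mul]
      have h2 := abs_sub_abs_le_abs_sub (x 2) (-v 2)
      rw [abs_neg, sub_neg_eq_add] at h2
      simp only [Pi.add_apply]
      linarith
  have hs : ∀ (k : Fin 3) , |(Pi.single k 1 : Fin 3 → ℝ) 2| ≤ 1 := by
    intro k; fin_cases k <;> simp
  have hsz : ∀ (k : Fin 3) (s : ℝ), |s| = |t| → |(s • (Pi.single k 1 : Fin 3 → ℝ)) 2| ≤ |t| := by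
    intro k s h
    simp only [Pi.smul_apply, smul_eq_mul, abs_mul, h]
    nlinarith [hs k, abs_nonneg t]
  have per : ∀ (v w x : Fin 3 → ℝ), f (x + P • (Pi.single 0 1 : Fin 3 → ℝ) + v)
      * g (x + P • (Pi.single 0 1 : Fin 3 → ℝ) + w) = f (x + v) * g (x + w) := by
    intro v w x
    rw [add_right_comm, add_right_comm x _ w, hf.per0, hg.per0]
  have per' : ∀ (v w x : Fin 3 → ℝ), f (x + Q • (Pi.single 1 1 : Fin 3 → ℝ) + v)
      * g (x + Q • (Pi.single 1 1 : Fin 3 → ℝ) + w) = f (x + v) * g (x + w) := by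
    intro v w x
    rw [add_right_comm, add_right_comm x _ w, hf.per1, hg.per1]
  set ei : Fin 3 → ℝ := Pi.single i 1 with hei
  set ej : Fin 3 → ℝ := Pi.single j 1 with hej
  have hz : |(0 : Fin 3 → ℝ) 2| ≤ 2 * |t| := by simp
  have bi : |(t • ei) 2| ≤ |t| := hsz i t rfl
  have bj : |(t • ej) 2| ≤ |t| := hsz j t rfl
  have bi' : |((-t) • ei) 2| ≤ |t| := hsz i (-t) (abs_neg t)
  have bj' : |((-t) • ej) 2| ≤ |t| := hsz j (-t) (abs_neg t)
  have at0 := abs_nonneg t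
  -- shift along a coordinate
  have sh : ∀ (k : Fin 3) (s : ℝ) (v w : Fin 3 → ℝ), |v 2| ≤ 2 * |t| →
      |(s • (Pi.single k 1 : Fin 3 → ℝ) + v) 2| ≤ 2 * |t| →
      ∫ x, f (x + (s • (Pi.single k 1 : Fin 3 → ℝ) + v)) *
        g (x + (s • (Pi.single k 1 : Fin 3 → ℝ) + w)) ∂(kmu P Q)
      = ∫ x, f (x + v) * g (x + w) ∂(kmu P Q) := by
    intro k s v w hv hv'
    have := kmu_shift P Q hP hQ k s (fun x => f (x + v) * g (x + w)) (per v w) (per' v w)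
      (prod_int v w hv) (by
        have := prod_int (s • (Pi.single k 1 : Fin 3 → ℝ) + v)
          (s • (Pi.single k 1 : Fin 3 → ℝ) + w) hv'
        simpa only [add_assoc] using this)
    simpa only [add_assoc] using this
  have e1 : ∫ x, f (x + t • ei) * g (x + t • ej) ∂(kmu P Q)
      = ∫ x, f (x + (-t) • ej) * g (x + (-t) • ei) ∂(kmu P Q) := by
    have h1 := sh i t ((-t) • ej) ((-t) • ei) (by linarith) (by
      rw [Pi.add_apply]
      refine (abs_add_le _ _).trans ?_
      linarith)
    have h2 := sh j (-t) (t • ei) (t • ej) (by linarith) (by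
      rw [Pi.add_apply]
      refine (abs_add_le _ _).trans ?_
      linarith)
    rw [← h1, ← h2]
    congr 1; ext x
    rw [← hei, ← hej]
    congr 2
    · rw [add_comm (t • ei)]
    · simp
  have e2 : ∫ x, f (x + t • ei) * g (x + 0) ∂(kmu P Q)
      = ∫ x, f (x + 0) * g (x + (-t) • ei) ∂(kmu P Q) := by
    have h1 := sh i t 0 ((-t) • ei) (by linarith) (by
      rw [add_zero]; change |(t • ei) 2| ≤ _; linarith)
    rw [← h1]
    congr 1; ext x
    rw [← hei]
    congr 2
    · simp
    · simp
  have e3 : ∫ x, f (x + 0) * g (x + t • ej) ∂(kmu P Q)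
      = ∫ x, f (x + (-t) • ej) * g (x + 0) ∂(kmu P Q) := by
    have h1 := sh j t ((-t) • ej) 0 (by linarith) (by
      rw [Pi.add_apply]
      refine (abs_add_le _ _).trans ?_
      linarith)
    rw [← h1]
    congr 1; ext x
    rw [← hej]
    congr 2
    · simp
    · simp
  have expand : ∀ (s : ℝ) (v w : Fin 3 → ℝ), |v 2| ≤ 2 * |t| →
      ∫ x, (s * (f (x + v) - f x)) * (s * (g (x + w) - g x)) ∂(kmu P Q)
      = s ^ 2 * (∫ x, f (x + v) * g (x + w) ∂(kmu P Q) - ∫ x, f (x + v) * g (x + 0) ∂(kmu P Q)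
        - ∫ x, f (x + 0) * g (x + w) ∂(kmu P Q) + ∫ x, f (x + 0) * g (x + 0) ∂(kmu P Q)) := by
    intro s v w hv
    have i1 := prod_int v w hv
    have i2 := prod_int v 0 hv
    have i3 := prod_int 0 w hz
    have i4 := prod_int 0 0 hz
    have : ∀ x, (s * (f (x + v) - f x)) * (s * (g (x + w) - g x))
      = s ^ 2 * (f (x + v) * g (x + w) - f (x + v) * g (x + 0) - f (x + 0) * g (x + w)
        + f (x + 0) * g (x + 0)) := by
      intro x; rw [add_zero]; ring
    simp_rw [this]
    rw [integral_const_mul, integral_add (by exact (i1.sub i2).sub i3) i4,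
      integral_sub (by exact i1.sub i2) i3,
      integral_sub i1 i2]
  unfold kdq
  rw [← hei, ← hej, expand _ _ _ (by linarith), expand _ _ _ (by linarith), e1, e2, e3]
  have : (-t)⁻¹ ^ 2 = t⁻¹ ^ 2 := by rw [inv_neg]; ring
  rw [this]; ring

/-- The commutation identity `∫ ∂ᵢf ∂ⱼg = ∫ ∂ⱼf ∂ᵢg`. -/
lemma KGood.comm {P Q M : ℝ} {K K' : NNReal} {f g : (Fin 3 → ℝ) → ℝ} (hP : 0 < P) (hQ : 0 < Q)
    (hf : KGood P Q M K f) (hg : KGood P Q M K' g) (i j : Fin 3) :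
    ∫ x, kld f i x * kld g j x ∂(kmu P Q) = ∫ x, kld f j x * kld g i x ∂(kmu P Q) := by
  have h1 := hf.lim hg i j
  have h2 := hf.lim hg j i
  have hneg : Filter.Tendsto (fun t : ℝ => -t) (nhdsWithin 0 {0}ᶜ) (nhdsWithin 0 {0}ᶜ) := by
    apply tendsto_nhdsWithin_iff.2
    constructor
    · have : Filter.Tendsto (fun t : ℝ => -t) (nhds 0) (nhds (-0)) := continuous_neg.tendsto 0
      rw [neg_zero] at this
      exact this.mono_left nhdsWithin_le_nhds
    · filter_upwards [self_mem_nhdsWithin] with t ht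
      simpa using ht
  have h3 := h2.comp hneg
  refine tendsto_nhds_unique h1 (h3.congr fun t => ?_)
  simp only [Function.comp]
  rw [hf.disc hP hQ hg i j t]

lemma KGood.int_mul {P Q M : ℝ} {K K' : NNReal} {f g : (Fin 3 → ℝ) → ℝ}
    (hf : KGood P Q M K f) (hg : KGood P Q M K' g) (i j : Fin 3) :
    Integrable (fun x => kld f i x * kld g j x) (kmu P Q) := by
  refine kmu_integrable P Q M (K * K') _
    ((hf.kld_meas i).mul (hg.kld_meas j)).aestronglyMeasurable ?_ ?_
  · intro x
    rw [abs_mul]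
    exact mul_le_mul (hf.kld_bdd _ _) (hg.kld_bdd _ _) (abs_nonneg _) (by positivity)
  · intro x hx
    rw [hf.kld_supp i x hx, zero_mul]

lemma KGood.int_sq {P Q M : ℝ} {K : NNReal} {f : (Fin 3 → ℝ) → ℝ}
    (hf : KGood P Q M K f) : Integrable (fun x => f x ^ 2) (kmu P Q) := by
  have := hf.lip.continuous
  refine kmu_integrable P Q M ((K * |2 * M + 1|) ^ 2) _ (by fun_prop) ?_ ?_
  · intro x
    rw [abs_pow]
    exact pow_le_pow_left₀ (abs_nonneg _) (hf.bdd x) 2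
  · intro x hx
    rw [hf.supp x hx]; simp

/-- Poincare inequality in the vertical direction. -/
lemma KGood.poincare {P Q M : ℝ} {K : NNReal} {f : (Fin 3 → ℝ) → ℝ} (hP : 0 < P) (hQ : 0 < Q)
    (hf : KGood P Q M K f) :
    ∫ x, f x ^ 2 ∂(kmu P Q) ≤ 4 * M ^ 2 * ∫ x, kld f 2 x * kld f 2 x ∂(kmu P Q) := by
  have cf := hf.lip.continuous
  set V : ℝ := K * |2 * M + 1| with hV
  have hV0 : 0 ≤ V := by positivity
  set F : (Fin 3 → ℝ) → ℝ := fun x => x 2 * f x ^ 2 with hF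
  have cF : Continuous F := by fun_prop
  have Fsupp : ∀ x, M < |x 2| → F x = 0 := by
    intro x hx; simp [hF, hf.supp x hx]
  have Fb : ∀ x, |F x| ≤ |M| * V ^ 2 := by
    intro x
    by_cases hx : M < |x 2|
    · rw [Fsupp x hx]; simp; positivity
    · rw [hF, abs_mul, abs_pow]
      exact mul_le_mul ((not_lt.1 hx).trans (le_abs_self M))
        (pow_le_pow_left₀ (abs_nonneg _) (hf.bdd x) 2) (by positivity) (by positivity)
  have iF : Integrable F (kmu P Q) :=
    kmu_integrable P Q M (|M| * V ^ 2) F cF.aestronglyMeasurable Fb Fsupp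
  have iFt : ∀ t : ℝ, Integrable (fun x => F (x + t • Pi.single 2 1)) (kmu P Q) := by
    intro t
    exact kmu_integrable P Q (M + |t|) (|M| * V ^ 2) _ (by fun_prop) (fun x => Fb _)
      (fun x hx => Fsupp _ (abs_shift_two x 2 t M hx))
  have zero : ∀ t : ℝ, ∫ x, kdq F 2 t x ∂(kmu P Q) = 0 := by
    intro t
    unfold kdq
    rw [integral_const_mul, integral_sub (iFt t) iF, kmu_shift P Q hP hQ 2 t F ?_ ?_ iF (iFt t)]
    · simp
    · intro x; simp [hF, hf.per0]
    · intro x; simp [hF, hf.per1]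
  have hsmall : ∀ᶠ t : ℝ in nhdsWithin 0 {0}ᶜ, |t| < 1 := by
    apply eventually_nhdsWithin_of_eventually_nhds
    exact (continuous_abs.continuousAt).eventually_lt continuous_const.continuousAt (by simp)
  have hne : ∀ᶠ t : ℝ in nhdsWithin 0 {0}ᶜ, t ≠ 0 := self_mem_nhdsWithin
  have lim : Filter.Tendsto (fun t => ∫ x, kdq F 2 t x ∂(kmu P Q)) (nhdsWithin 0 {0}ᶜ)
      (nhds (∫ x, (f x ^ 2 + 2 * (x 2 * (f x * kld f 2 x))) ∂(kmu P Q))) := by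
    refine tendsto_integral_filter_of_dominated_convergence
      ({x : Fin 3 → ℝ | |x 2| ≤ M + 1}.indicator (fun _ => V ^ 2 + |M + 1| * (K * (2 * V))))
      ?_ ?_ (kint_const _ _ _ _) ?_
    · refine Filter.Eventually.of_forall fun t => ?_
      unfold kdq
      exact Continuous.aestronglyMeasurable (by fun_prop)
    · filter_upwards [hsmall, hne] with t ht ht0
      refine Filter.Eventually.of_forall fun x => ?_
      by_cases hx : |x 2| ≤ M + 1
      · simp only [Set.indicator, Set.mem_ofPred_eq, hx, if_true, Real.norm_eq_abs]
        have e : kdq F 2 t x = f (x + t • Pi.single 2 1) ^ 2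
            + x 2 * (kdq f 2 t x * (f (x + t • Pi.single 2 1) + f x)) := by
          simp only [kdq, hF, Pi.add_apply, Pi.smul_apply, smul_eq_mul, Pi.single_eq_same]
          field_simp
          ring
        rw [e]
        refine (abs_add_le _ _).trans (add_le_add ?_ ?_)
        · rw [abs_pow]
          exact pow_le_pow_left₀ (abs_nonneg _) (hf.bdd _) 2
        · rw [abs_mul, abs_mul]
          have h3 : |f (x + t • Pi.single 2 1) + f x| ≤ 2 * V :=
            (abs_add_le _ _).trans (by linarith [hf.bdd x, hf.bdd (x + t • Pi.single 2 1)])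
          exact mul_le_mul (hx.trans (le_abs_self _))
            (mul_le_mul (hf.kdq_bdd 2 t x) h3 (abs_nonneg _) (by positivity))
            (by positivity) (by positivity)
      · have : kdq F 2 t x = 0 := by
          rw [kdq, Fsupp x (by linarith),
            Fsupp _ (abs_shift_two x 2 t M (by linarith))]
          simp
        rw [this]
        simp [Set.indicator, hx]
    · filter_upwards [hf.kld_ae 2] with x h1
      have h2 : HasLineDerivAt ℝ F (f x ^ 2 + 2 * (x 2 * (f x * kld f 2 x))) x (Pi.single 2 1) := by
        unfold HasLineDerivAt at h1 ⊢
        have h3 : HasDerivAt (fun t : ℝ => x 2 + t) 1 0 := (hasDerivAt_id (0:ℝ)).const_add _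
        have h4 := h3.mul (h1.pow 2)
        have e : (fun t : ℝ => F (x + t • Pi.single 2 1))
            = (fun t => x 2 + t) * (fun t => f (x + t • Pi.single 2 1)) ^ 2 := by
          ext t; simp [hF]
        rw [e]
        refine h4.congr_deriv ?_
        simp
        ring
      exact h2.tendsto_slope_zero
  have id0 : ∫ x, (f x ^ 2 + 2 * (x 2 * (f x * kld f 2 x))) ∂(kmu P Q) = 0 := by
    refine tendsto_nhds_unique lim ?_
    simp only [zero]
    exact tendsto_const_nhds
  have i1 := hf.int_sq
  have i2 := hf.int_mul hf 2 2
  have i3 : Integrable (fun x => (f x ^ 2 + 2 * (x 2 * (f x * kld f 2 x)))) (kmu P Q) := by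
    have m := hf.kld_meas 2
    refine kmu_integrable P Q M (V ^ 2 + 2 * (|M| * (V * K))) _
      (Measurable.aestronglyMeasurable (by fun_prop)) ?_ ?_
    · intro x
      by_cases hx : M < |x 2|
      · rw [hf.supp x hx]; simp; positivity
      · refine (abs_add_le _ _).trans (add_le_add ?_ ?_)
        · rw [abs_pow]
          exact pow_le_pow_left₀ (abs_nonneg _) (hf.bdd _) 2
        · rw [abs_mul, abs_mul, abs_mul, abs_two]
          have := mul_le_mul ((not_lt.1 hx).trans (le_abs_self _)) (mul_le_mul (hf.bdd x) (hf.kld_bdd 2 x)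
            (abs_nonneg _) hV0) (by positivity) (by positivity)
          linarith
    · intro x hx; rw [hf.supp x hx]; simp
  have pt : ∀ x, f x ^ 2 ≤ 2 * (f x ^ 2 + 2 * (x 2 * (f x * kld f 2 x)))
      + 4 * M ^ 2 * (kld f 2 x * kld f 2 x) := by
    intro x
    by_cases hx : M < |x 2|
    · rw [hf.supp x hx, hf.kld_supp 2 x hx]; simp
    · have h5 : x 2 ^ 2 ≤ M ^ 2 := by
        rw [← sq_abs (x 2)]
        exact pow_le_pow_left₀ (abs_nonneg _) (not_lt.1 hx) 2
      nlinarith [sq_nonneg (f x + 2 * (x 2 * kld f 2 x)),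
        mul_le_mul_of_nonneg_right h5 (mul_self_nonneg (kld f 2 x))]
  have := integral_mono i1 ((i3.const_mul 2).add (i2.const_mul (4 * M ^ 2))) pt
  simp only [Pi.add_apply] at this
  rw [integral_add (i3.const_mul 2) (i2.const_mul (4 * M ^ 2)), integral_const_mul,
    integral_const_mul, id0] at this
  linarith

/-- Korn on the whole periodic space. -/
lemma kkorn {P Q M : ℝ} (hP : 0 < P) (hQ : 0 < Q) (K : Fin 3 → NNReal)
    (v : Fin 3 → (Fin 3 → ℝ) → ℝ) (hv : ∀ j, KGood P Q M (K j) (v j)) :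
    ∫ x, (∑ j, v j x ^ 2) + ∑ i, ∑ j, kld (v j) i x ^ 2 ∂(kmu P Q)
      ≤ (4 * M ^ 2 + 1) * ∫ x, ∑ i, ∑ j, (kld (v j) i x + kld (v i) j x) ^ 2 ∂(kmu P Q) := by
  have im : ∀ i j k l, Integrable (fun x => kld (v j) i x * kld (v l) k x) (kmu P Q) :=
    fun i j k l => (hv j).int_mul (hv l) i k
  have is : ∀ i j, Integrable (fun x => kld (v j) i x ^ 2) (kmu P Q) := by
    intro i j; simpa only [sq] using im i j i j
  set A : ℝ := ∑ i, ∑ j, ∫ x, kld (v j) i x ^ 2 ∂(kmu P Q) with hA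
  have hA0 : 0 ≤ A := Finset.sum_nonneg fun i _ => Finset.sum_nonneg fun j _ =>
    integral_nonneg fun x => sq_nonneg _
  have h1 : ∫ x, (∑ j, v j x ^ 2) + ∑ i, ∑ j, kld (v j) i x ^ 2 ∂(kmu P Q)
      ≤ (4 * M ^ 2 + 1) * A := by
    rw [integral_add (integrable_finsetSum _ fun j _ => (hv j).int_sq)
      (integrable_finsetSum _ fun i _ => integrable_finsetSum _ fun j _ => is i j),
      integral_finsetSum _ (fun j _ => (hv j).int_sq),
      integral_finsetSum _ (fun i _ => integrable_finsetSum _ fun j _ => is i j)]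
    simp_rw [integral_finsetSum _ (fun j _ => is _ j)]
    rw [← hA, add_mul, one_mul]
    refine add_le_add_left ?_ _
    have h2 : ∑ j, ∫ x, kld (v j) 2 x ^ 2 ∂(kmu P Q) ≤ A :=
      Finset.single_le_sum (f := fun i => ∑ j, ∫ x, kld (v j) i x ^ 2 ∂(kmu P Q))
        (fun i _ => Finset.sum_nonneg fun j _ => integral_nonneg fun x => sq_nonneg _)
        (Finset.mem_univ 2)
    refine le_trans ?_ (mul_le_mul_of_nonneg_left h2 (by positivity))
    rw [Finset.mul_sum]
    refine Finset.sum_le_sum fun j _ => ?_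
    have := (hv j).poincare hP hQ
    simpa only [← sq] using this
  refine h1.trans (mul_le_mul_of_nonneg_left ?_ (by positivity))
  have e : ∀ x, ∑ i, ∑ j, (kld (v j) i x + kld (v i) j x) ^ 2
      = ∑ i, ∑ j, (kld (v j) i x ^ 2 + kld (v i) j x ^ 2
        + 2 * (kld (v j) i x * kld (v i) j x)) := by
    intro x
    refine Finset.sum_congr rfl fun i _ => Finset.sum_congr rfl fun j _ => by ring
  simp_rw [e]
  have i5 : ∀ i j, Integrable (fun x => kld (v j) i x ^ 2 + kld (v i) j x ^ 2
        + 2 * (kld (v j) i x * kld (v i) j x)) (kmu P Q) := fun i j =>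
    ((is i j).add (is j i)).add ((im i j j i).const_mul 2)
  rw [integral_finsetSum _ (fun i _ => integrable_finsetSum _ fun j _ => i5 i j)]
  simp_rw [integral_finsetSum _ (fun j _ => i5 _ j)]
  have e2 : ∀ i j, ∫ x, (kld (v j) i x ^ 2 + kld (v i) j x ^ 2
        + 2 * (kld (v j) i x * kld (v i) j x)) ∂(kmu P Q)
      = ∫ x, kld (v j) i x ^ 2 ∂(kmu P Q) + ∫ x, kld (v i) j x ^ 2 ∂(kmu P Q)
        + 2 * ∫ x, kld (v j) j x * kld (v i) i x ∂(kmu P Q) := by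
    intro i j
    rw [integral_add (by exact (is i j).add (is j i)) ((im i j j i).const_mul 2),
      integral_add (is i j) (is j i), integral_const_mul, (hv j).comm hP hQ (hv i) i j]
  simp_rw [e2, Finset.sum_add_distrib]
  have e3 : ∑ i, ∑ j, ∫ x, kld (v i) j x ^ 2 ∂(kmu P Q) = A := Finset.sum_comm
  rw [e3, ← hA]
  have e4 : 0 ≤ ∑ i, ∑ j, 2 * ∫ x, kld (v j) j x * kld (v i) i x ∂(kmu P Q) := by
    have : ∑ i, ∑ j, 2 * ∫ x, kld (v j) j x * kld (v i) i x ∂(kmu P Q)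
      = 2 * ∫ x, (∑ i, kld (v i) i x) ^ 2 ∂(kmu P Q) := by
      have : ∀ x, (∑ i, kld (v i) i x) ^ 2 = ∑ i, ∑ j, kld (v j) j x * kld (v i) i x := by
        intro x
        rw [sq, Finset.sum_mul_sum]
        exact Finset.sum_comm
      simp_rw [this]
      rw [integral_finsetSum _ (fun i _ => integrable_finsetSum _ fun j _ => im j j i i)]
      simp_rw [integral_finsetSum _ (fun j _ => im j j _ _), Finset.mul_sum]
    rw [this]
    exact mul_nonneg zero_le_two (integral_nonneg fun x => sq_nonneg _)
  linarith

/-- horizontally periodic continuous functions are bounded on slabs -/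
lemma kper_bdd {F : Type*} [NormedAddCommGroup F] (P Q B : ℝ) (hP : 0 < P) (hQ : 0 < Q)
    (g : (Fin 3 → ℝ) → F) (hg : Continuous g)
    (hp0 : ∀ x, g (x + P • (Pi.single 0 1 : Fin 3 → ℝ)) = g x)
    (hp1 : ∀ x, g (x + Q • (Pi.single 1 1 : Fin 3 → ℝ)) = g x) :
    ∃ C : NNReal, ∀ x, -B ≤ x 2 → x 2 ≤ 1 → ‖g x‖₊ ≤ C := by
  have hc : IsCompact (Set.Icc (![0, 0, -B] : Fin 3 → ℝ) ![P, Q, 1]) := isCompact_Icc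
  obtain ⟨C, hC⟩ := hc.exists_bound_of_continuousOn hg.continuousOn
  refine ⟨C.toNNReal, fun x h1 h2 => ?_⟩
  have p0 : ∀ x, Function.Periodic (fun t : ℝ => g (x + t • (Pi.single 0 1 : Fin 3 → ℝ))) P := by
    intro x t
    change g _ = g _
    rw [add_smul, ← add_assoc, hp0]
  have p1 : ∀ x, Function.Periodic (fun t : ℝ => g (x + t • (Pi.single 1 1 : Fin 3 → ℝ))) Q := by
    intro x t
    change g _ = g _
    rw [add_smul, ← add_assoc, hp1]
  obtain ⟨s, hs, es⟩ := (p0 x).exists_mem_Ico hP 0 (-x 0)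
  obtain ⟨r, hr, er⟩ := (p1 (x + s • (Pi.single 0 1 : Fin 3 → ℝ))).exists_mem_Ico hQ 0 (-x 1)
  have e : g x = g (x + s • (Pi.single 0 1 : Fin 3 → ℝ) + r • (Pi.single 1 1 : Fin 3 → ℝ)) := by
    simp only [zero_smul, add_zero] at es er
    rw [es, er]
  rw [e]
  rw [← NNReal.coe_le_coe, coe_nnnorm]
  refine (hC _ ?_).trans (Real.le_coe_toNNReal C)
  rw [Set.mem_Icc, Pi.le_def, Pi.le_def]
  simp only [Set.mem_Ico] at hs hr
  constructor
  · intro k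
    fin_cases k
    · simp; linarith
    · simp; linarith
    · simpa using h1
  · intro k
    fin_cases k
    · simp; linarith
    · simp; linarith
    · simpa using h2

lemma kfderiv_bdd (P Q B : ℝ) (hP : 0 < P) (hQ : 0 < Q)
    (f : (Fin 3 → ℝ) → ℝ) (hf : ContDiff ℝ 1 f)
    (hp0 : ∀ x, f (x + P • (Pi.single 0 1 : Fin 3 → ℝ)) = f x)
    (hp1 : ∀ x, f (x + Q • (Pi.single 1 1 : Fin 3 → ℝ)) = f x) :
    ∃ C : NNReal, ∀ x, -B ≤ x 2 → x 2 ≤ 1 → ‖fderiv ℝ f x‖₊ ≤ C := by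
  refine kper_bdd P Q B hP hQ (fderiv ℝ f) (hf.continuous_fderiv (by norm_num)) ?_ ?_
  · intro x
    rw [← fderiv_comp_add_right]
    congr 1; ext y; exact hp0 y
  · intro x
    rw [← fderiv_comp_add_right]
    congr 1; ext y; exact hp1 y

lemma kb_facts (P Q : ℝ) (hP : 0 < P) (hQ : 0 < Q) (b : ℝ × ℝ → ℝ) (hb : ContDiff ℝ 1 b)
    (hp0 : ∀ p : ℝ × ℝ, b (p.1 + P, p.2) = b p)
    (hp1 : ∀ p : ℝ × ℝ, b (p.1, p.2 + Q) = b p) :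
    (∃ B : ℝ, ∀ p, b p ≤ B) ∧ ∃ K, LipschitzWith K b := by
  constructor
  · obtain ⟨C, hC⟩ := kper_bdd P Q 0 hP hQ (fun x => b (x 0, x 1)) (by have := hb.continuous; fun_prop)
      (by intro x; simpa using hp0 (x 0, x 1)) (by intro x; simpa using hp1 (x 0, x 1))
    refine ⟨C, fun p => ?_⟩
    have := hC ![p.1, p.2, 0] (by simp) (by simp)
    have h2 : ‖b p‖ ≤ C := by exact_mod_cast this
    exact (le_abs_self _).trans h2
  · have hcd := hb.continuous_fderiv (by norm_num)
    obtain ⟨C, hC⟩ := kper_bdd P Q 0 hP hQ (fun x => fderiv ℝ b (x 0, x 1)) (by fun_prop)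
      (by
        intro x
        have := fderiv_comp_add_right (𝕜 := ℝ) (f := b) (x := (x 0, x 1)) ((P, 0) : ℝ × ℝ)
        simp only [Prod.mk_add_mk, add_zero] at this
        simp
        rw [← this]
        congr 1; ext y
        have hy : y + (P, 0) = (y.1 + P, y.2) := by ext <;> simp
        rw [hy]; exact hp0 y)
      (by
        intro x
        have := fderiv_comp_add_right (𝕜 := ℝ) (f := b) (x := (x 0, x 1)) ((0, Q) : ℝ × ℝ)
        simp only [Prod.mk_add_mk, add_zero] at this
        simp
        rw [← this]
        congr 1; ext y
        have hy : y + (0, Q) = (y.1, y.2 + Q) := by ext <;> simp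
        rw [hy]; exact hp1 y)
    refine ⟨C, lipschitzWith_of_nnnorm_fderiv_le (hb.differentiable (by norm_num)) fun p => ?_⟩
    exact hC ![p.1, p.2, 0] (by simp) (by simp)

/-- vertical clamping map -/
noncomputable def kN (b : ℝ × ℝ → ℝ) (m : ℝ → ℝ) (x : Fin 3 → ℝ) : Fin 3 → ℝ :=
  ![x 0, x 1, max (m (x 2)) (-b (x 0, x 1))]

lemma kN_lip (b : ℝ × ℝ → ℝ) (m : ℝ → ℝ) {K K' : NNReal} (hb : LipschitzWith K b)
    (hm : LipschitzWith K' m) : ∃ K'', LipschitzWith K'' (kN b m) := by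
  have h1 : LipschitzWith _ (fun x : Fin 3 → ℝ => (x 0, x 1)) :=
    (LipschitzWith.eval (α := fun _ => ℝ) 0).prodMk (LipschitzWith.eval (α := fun _ => ℝ) 1)
  have h2 := (hm.comp (LipschitzWith.eval (α := fun _ : Fin 3 => ℝ) 2)).max (hb.comp h1).neg
  set K3 := max (K' * 1) (K * max 1 1) with hK3
  refine ⟨max 1 K3, LipschitzWith.of_dist_le_mul fun x y => ?_⟩
  rw [dist_pi_le_iff (by positivity)]
  have a1 : ∀ i, dist (x i) (y i) ≤ (max 1 K3 : NNReal) * dist x y := by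
    intro i
    refine (dist_le_pi_dist x y i).trans (le_mul_of_one_le_left dist_nonneg ?_)
    exact_mod_cast le_max_left 1 K3
  intro i
  fin_cases i
  · exact a1 0
  · exact a1 1
  · refine (h2.dist_le_mul x y).trans (mul_le_mul_of_nonneg_right ?_ dist_nonneg)
    exact_mod_cast le_max_right 1 K3

/-- first fold -/
noncomputable def km1 (t : ℝ) : ℝ := min t (2 - t)
/-- second fold -/
noncomputable def km2 (t : ℝ) : ℝ := min t (3 - 2 * t)
/-- first weights -/
def ks1 : Fin 3 → ℝ := ![1, 1, -1]
/-- second weights -/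
def ks2 : Fin 3 → ℝ := ![1, 1, -2]

/-- The Nitsche-type extension. -/
noncomputable def kext (b : ℝ × ℝ → ℝ) (u : (Fin 3 → ℝ) → (Fin 3 → ℝ)) (j : Fin 3)
    (x : Fin 3 → ℝ) : ℝ :=
  3 * ks1 j * u (kN b km1 x) j - 2 * ks2 j * u (kN b km2 x) j

lemma km1_lip : LipschitzWith 2 km1 := by
  refine LipschitzWith.of_dist_le_mul fun x y => ?_
  simp only [Real.dist_eq, km1, NNReal.coe_ofNat]
  refine (abs_min_sub_min_le_max _ _ _ _).trans (max_le ?_ ?_)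
  · linarith [abs_nonneg (x - y)]
  · rw [show 2 - x - (2 - y) = -(x - y) by ring, abs_neg]; linarith [abs_nonneg (x - y)]

lemma km2_lip : LipschitzWith 2 km2 := by
  refine LipschitzWith.of_dist_le_mul fun x y => ?_
  simp only [Real.dist_eq, km2, NNReal.coe_ofNat]
  refine (abs_min_sub_min_le_max _ _ _ _).trans (max_le ?_ ?_)
  · linarith [abs_nonneg (x - y)]
  · rw [show 3 - 2 * x - (3 - 2 * y) = -(2 * (x - y)) by ring, abs_neg, abs_mul, abs_two]

lemma km1_le (t : ℝ) : km1 t ≤ 1 := by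
  unfold km1; rcases le_total t 1 with h | h
  · exact (min_le_left _ _).trans h
  · exact (min_le_right _ _).trans (by linarith)

lemma km2_le (t : ℝ) : km2 t ≤ 1 := by
  unfold km2; rcases le_total t 1 with h | h
  · exact (min_le_left _ _).trans h
  · exact (min_le_right _ _).trans (by linarith)

lemma kN_good (P Q B M : ℝ) (hP : 0 < P) (hQ : 0 < Q) (b : ℝ × ℝ → ℝ) (hbpos : ∀ p, 0 < b p)
    (hB : ∀ p, b p ≤ B) {K K' : NNReal} (hbl : LipschitzWith K b)
    (hp0 : ∀ p : ℝ × ℝ, b (p.1 + P, p.2) = b p)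
    (hp1 : ∀ p : ℝ × ℝ, b (p.1, p.2 + Q) = b p)
    (m : ℝ → ℝ) (hm : LipschitzWith K' m) (hm1 : ∀ t, m t ≤ 1)
    (hmM : ∀ t, M < |t| → m t ≤ -B)
    (f : (Fin 3 → ℝ) → ℝ) (hf : ContDiff ℝ 1 f)
    (hf0 : ∀ x, f (x + P • (Pi.single 0 1 : Fin 3 → ℝ)) = f x)
    (hf1 : ∀ x, f (x + Q • (Pi.single 1 1 : Fin 3 → ℝ)) = f x)
    (hfb : ∀ p : ℝ × ℝ, f ![p.1, p.2, -b p] = 0) :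
    ∃ K, KGood P Q M K (fun x => f (kN b m x)) := by
  obtain ⟨C, hC⟩ := kfderiv_bdd P Q B hP hQ f hf hf0 hf1
  obtain ⟨K2, hK2⟩ := kN_lip b m hbl hm
  have hconv : Convex ℝ {x : Fin 3 → ℝ | -B ≤ x 2 ∧ x 2 ≤ 1} := by
    intro x hx y hy s t hs ht hst
    simp only [Set.mem_ofPred_eq, Pi.add_apply, Pi.smul_apply, smul_eq_mul] at hx hy ⊢
    constructor <;> nlinarith [hx.1, hx.2, hy.1, hy.2]
  have hl : LipschitzOnWith C f {x : Fin 3 → ℝ | -B ≤ x 2 ∧ x 2 ≤ 1} :=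
    hconv.lipschitzOnWith_of_nnnorm_fderiv_le (𝕜 := ℝ)
      (fun x _ => hf.differentiable (by norm_num) x) (fun x hx => hC x hx.1 hx.2)
  refine ⟨C * K2, ?_, ?_, ?_, ?_⟩
  · rw [← lipschitzOnWith_univ]
    refine hl.comp (hK2.lipschitzOnWith (s := Set.univ)) ?_
    intro x _
    simp only [kN, Set.mem_ofPred_eq, Matrix.cons_val]
    constructor
    · exact le_trans (by linarith [hB (x 0, x 1)]) (le_max_right _ _)
    · exact max_le (hm1 _) (by linarith [hbpos (x 0, x 1)])
  · intro x
    rw [← hf0 (kN b m x)]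
    congr 1; ext k
    have := hp0 (x 0, x 1)
    fin_cases k <;> simp_all [kN]
  · intro x
    rw [← hf1 (kN b m x)]
    congr 1; ext k
    have := hp1 (x 0, x 1)
    fin_cases k <;> simp_all [kN]
  · intro x hx
    have := hfb (x 0, x 1)
    rw [← this]
    congr 1
    simp only [kN]
    rw [max_eq_right]
    linarith [hmM _ hx, hB (x 0, x 1)]

lemma KGood.comb {P Q M : ℝ} {K K' : NNReal} {f g : (Fin 3 → ℝ) → ℝ} (hf : KGood P Q M K f)
    (hg : KGood P Q M K' g) (a c : ℝ) : ∃ K'', KGood P Q M K'' (fun x => a * f x - c * g x) := by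
  have h1 := ((lipschitzWith_smul a).comp hf.lip).sub ((lipschitzWith_smul c).comp hg.lip)
  refine ⟨_, h1, ?_, ?_, ?_⟩
  · intro x; simp only [hf.per0, hg.per0]
  · intro x; simp only [hf.per1, hg.per1]
  · intro x hx; simp [hf.supp x hx, hg.supp x hx]

lemma kext_good (P Q B : ℝ) (hP : 0 < P) (hQ : 0 < Q) (b : ℝ × ℝ → ℝ) (hbpos : ∀ p, 0 < b p)
    (hB : ∀ p, b p ≤ B) {K : NNReal} (hbl : LipschitzWith K b)
    (hp0 : ∀ p : ℝ × ℝ, b (p.1 + P, p.2) = b p)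
    (hp1 : ∀ p : ℝ × ℝ, b (p.1, p.2 + Q) = b p)
    (u : (Fin 3 → ℝ) → (Fin 3 → ℝ)) (hu : ContDiff ℝ 1 u)
    (hf0 : ∀ x, u (x + P • (Pi.single 0 1 : Fin 3 → ℝ)) = u x)
    (hf1 : ∀ x, u (x + Q • (Pi.single 1 1 : Fin 3 → ℝ)) = u x)
    (hfb : ∀ p : ℝ × ℝ, u ![p.1, p.2, -b p] = 0) (j : Fin 3) :
    ∃ K, KGood P Q (B + 3) K (kext b u j) := by
  have huj : ContDiff ℝ 1 (fun z => u z j) := contDiff_pi.1 hu j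
  have hB0 : 0 < B := (hbpos 0).trans_le (hB 0)
  obtain ⟨K1, h1⟩ := kN_good P Q B (B + 3) hP hQ b hbpos hB hbl hp0 hp1 km1 km1_lip km1_le
    (by
      intro t ht
      unfold km1
      rcases lt_abs.1 ht with h | h
      · exact (min_le_right _ _).trans (by linarith)
      · exact (min_le_left _ _).trans (by linarith))
    (fun z => u z j) huj (fun x => by rw [hf0]) (fun x => by rw [hf1]) (fun p => by rw [hfb]; rfl)
  obtain ⟨K2, h2⟩ := kN_good P Q B (B + 3) hP hQ b hbpos hB hbl hp0 hp1 km2 km2_lip km2_le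
    (by
      intro t ht
      unfold km2
      rcases lt_abs.1 ht with h | h
      · exact (min_le_right _ _).trans (by linarith)
      · exact (min_le_left _ _).trans (by linarith))
    (fun z => u z j) huj (fun x => by rw [hf0]) (fun x => by rw [hf1]) (fun p => by rw [hfb]; rfl)
  exact h1.comb h2 (3 * ks1 j) (2 * ks2 j)

open Classical in
/-- gradient extended by zero outside of the fluid domain -/
noncomputable def kG (b : ℝ × ℝ → ℝ) (u : (Fin 3 → ℝ) → (Fin 3 → ℝ)) (i j : Fin 3)
    (x : Fin 3 → ℝ) : ℝ :=
  if -b (x 0, x 1) < x 2 ∧ x 2 < 1 then pd3 i (fun z => u z j) x else 0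

lemma kW_deriv (b : ℝ × ℝ → ℝ) (hb : Continuous b) (u : (Fin 3 → ℝ) → (Fin 3 → ℝ))
    (hu : ContDiff ℝ 1 u) (hfb : ∀ p : ℝ × ℝ, u ![p.1, p.2, -b p] = 0) (i j : Fin 3)
    (y : Fin 3 → ℝ) (hy : y 2 ≠ -b (y 0, y 1)) (hy1 : y 2 < 1) (s : ℝ) :
    HasLineDerivAt ℝ (fun z => u (kN b id z) j) (s * kG b u i j y) y (s • Pi.single i 1) := by
  have huj : ContDiff ℝ 1 (fun z => u z j) := contDiff_pi.1 hu j
  have c1 : Continuous (fun z : Fin 3 → ℝ => z 2) := continuous_apply 2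
  have c2 : Continuous (fun z : Fin 3 → ℝ => -b (z 0, z 1)) := by fun_prop
  rcases lt_or_gt_of_ne hy with h | h
  · have ev : (fun z => u (kN b id z) j) =ᶠ[nhds y] fun _ => 0 := by
      filter_upwards [c1.continuousAt.eventually_lt c2.continuousAt h] with z hz
      have : kN b id z = ![z 0, z 1, -b (z 0, z 1)] := by
        simp only [kN, id]; rw [max_eq_right hz.le]
      rw [this, hfb (z 0, z 1)]; rfl
    have hG : kG b u i j y = 0 := by
      rw [kG, if_neg]; intro h'; linarith [h'.1]
    rw [hG, mul_zero]
    exact ((hasFDerivAt_const (0 : ℝ) y).congr_of_eventuallyEq ev).hasLineDerivAt _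
  · have ev : (fun z => u (kN b id z) j) =ᶠ[nhds y] fun z => u z j := by
      filter_upwards [c2.continuousAt.eventually_lt c1.continuousAt h] with z hz
      have : kN b id z = z := by
        simp only [kN, id]; rw [max_eq_left hz.le]
        ext k; fin_cases k <;> rfl
      rw [this]
    have hG : s * kG b u i j y = fderiv ℝ (fun z => u z j) y (s • Pi.single i 1) := by
      rw [kG, if_pos ⟨h, hy1⟩, pd3, map_smul, smul_eq_mul]
    rw [hG]
    exact ((huj.differentiable (by norm_num) y).hasFDerivAt.congr_of_eventuallyEq ev).hasLineDerivAt _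

lemma kext_low (b : ℝ × ℝ → ℝ) (u : (Fin 3 → ℝ) → (Fin 3 → ℝ)) (j : Fin 3)
    (x : Fin 3 → ℝ) (hx : x 2 ≤ 1) : kext b u j x = u (kN b id x) j := by
  have e1 : kN b km1 x = kN b id x := by
    simp only [kN, km1, id]; rw [min_eq_left (by linarith)]
  have e2 : kN b km2 x = kN b id x := by
    simp only [kN, km2, id]; rw [min_eq_left (by linarith)]
  rw [kext, e1, e2]
  fin_cases j <;> simp [ks1, ks2] <;> ring

lemma kext_deriv_low (b : ℝ × ℝ → ℝ) (hb : Continuous b) (u : (Fin 3 → ℝ) → (Fin 3 → ℝ))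
    (hu : ContDiff ℝ 1 u) (hfb : ∀ p : ℝ × ℝ, u ![p.1, p.2, -b p] = 0) (i j : Fin 3)
    (x : Fin 3 → ℝ) (hx : x 2 ≠ -b (x 0, x 1)) (hx1 : x 2 < 1) :
    kld (kext b u j) i x = kG b u i j x := by
  have h := kW_deriv b hb u hu hfb i j x hx hx1 1
  rw [one_mul, one_smul] at h
  have ev : kext b u j =ᶠ[nhds x] (fun z => u (kN b id z) j) := by
    have c1 : Continuous (fun z : Fin 3 → ℝ => z 2) := continuous_apply 2
    filter_upwards [c1.continuousAt.eventually_lt continuousAt_const hx1] with z hz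
    exact kext_low b u j z hz.le
  rw [kld, ev.lineDeriv_eq]
  exact h.lineDeriv

/-- first reflection -/
noncomputable def kR1 (x : Fin 3 → ℝ) : Fin 3 → ℝ := Function.update x 2 (2 - x 2)
/-- second reflection -/
noncomputable def kR2 (x : Fin 3 → ℝ) : Fin 3 → ℝ := Function.update x 2 (3 - 2 * x 2)

lemma kR1_add (x : Fin 3 → ℝ) (i : Fin 3) (t : ℝ) :
    kR1 (x + t • Pi.single i 1) = kR1 x + t • (ks1 i • Pi.single i 1) := by
  ext k
  fin_cases i <;> fin_cases k <;> simp [kR1, ks1] <;> ring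

lemma kR2_add (x : Fin 3 → ℝ) (i : Fin 3) (t : ℝ) :
    kR2 (x + t • Pi.single i 1) = kR2 x + t • (ks2 i • Pi.single i 1) := by
  ext k
  fin_cases i <;> fin_cases k <;> simp [kR2, ks2] <;> ring

lemma kext_deriv_high (b : ℝ × ℝ → ℝ) (hb : Continuous b) (u : (Fin 3 → ℝ) → (Fin 3 → ℝ))
    (hu : ContDiff ℝ 1 u) (hfb : ∀ p : ℝ × ℝ, u ![p.1, p.2, -b p] = 0) (i j : Fin 3)
    (x : Fin 3 → ℝ) (hx : 2 - x 2 ≠ -b (x 0, x 1)) (hx' : 3 - 2 * x 2 ≠ -b (x 0, x 1))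
    (hx1 : 1 < x 2) :
    kld (kext b u j) i x = 3 * ks1 j * (ks1 i * kG b u i j (kR1 x))
      - 2 * ks2 j * (ks2 i * kG b u i j (kR2 x)) := by
  have h1 := kW_deriv b hb u hu hfb i j (kR1 x) (by simpa [kR1] using hx)
    (by simp [kR1]; linarith) (ks1 i)
  have h2 := kW_deriv b hb u hu hfb i j (kR2 x) (by simpa [kR2] using hx')
    (by simp [kR2]; linarith) (ks2 i)
  have h3 : HasLineDerivAt ℝ (fun z => 3 * ks1 j * u (kN b id (kR1 z)) j
      - 2 * ks2 j * u (kN b id (kR2 z)) j) (3 * ks1 j * (ks1 i * kG b u i j (kR1 x))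
      - 2 * ks2 j * (ks2 i * kG b u i j (kR2 x))) x (Pi.single i 1) := by
    unfold HasLineDerivAt at h1 h2 ⊢
    simp only [kR1_add, kR2_add]
    exact (h1.const_mul (3 * ks1 j)).sub (h2.const_mul (2 * ks2 j))
  have ev : kext b u j =ᶠ[nhds x] (fun z => 3 * ks1 j * u (kN b id (kR1 z)) j
      - 2 * ks2 j * u (kN b id (kR2 z)) j) := by
    have c1 : Continuous (fun z : Fin 3 → ℝ => z 2) := continuous_apply 2
    filter_upwards [continuousAt_const.eventually_lt c1.continuousAt hx1] with z hz
    have e1 : kN b km1 z = kN b id (kR1 z) := by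
      simp [kN, km1, kR1]; rw [min_eq_right (by linarith)]
    have e2 : kN b km2 z = kN b id (kR2 z) := by
      simp [kN, km2, kR2]; rw [min_eq_right (by linarith)]
    rw [kext, e1, e2]
  rw [kld, ev.lineDeriv_eq]
  exact h3.lineDeriv

/-- squared symmetric gradient extended by zero -/
noncomputable def kS (b : ℝ × ℝ → ℝ) (u : (Fin 3 → ℝ) → (Fin 3 → ℝ)) (x : Fin 3 → ℝ) : ℝ :=
  ∑ i, ∑ j, (kG b u i j x + kG b u j i x) ^ 2

lemma kS_nonneg (b : ℝ × ℝ → ℝ) (u : (Fin 3 → ℝ) → (Fin 3 → ℝ)) (x : Fin 3 → ℝ) :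
    0 ≤ kS b u x :=
  Finset.sum_nonneg fun i _ => Finset.sum_nonneg fun j _ => sq_nonneg _

lemma ksq_bound (i j : Fin 3) (A B A' B' : ℝ) :
    (3 * ks1 j * (ks1 i * A) - 2 * ks2 j * (ks2 i * B)
      + (3 * ks1 i * (ks1 j * A') - 2 * ks2 i * (ks2 j * B'))) ^ 2
    ≤ 128 * (A + A') ^ 2 + 128 * (B + B') ^ 2 := by
  have h1 : (ks1 i * ks1 j) ^ 2 ≤ 1 := by
    fin_cases i <;> fin_cases j <;> norm_num [ks1]
  have h2 : (ks2 i * ks2 j) ^ 2 ≤ 16 := by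
    fin_cases i <;> fin_cases j <;> norm_num [ks2]
  set p := ks1 i * ks1 j with hp
  set q := ks2 i * ks2 j with hq
  have e : (3 * ks1 j * (ks1 i * A) - 2 * ks2 j * (ks2 i * B)
      + (3 * ks1 i * (ks1 j * A') - 2 * ks2 i * (ks2 j * B')))
      = 3 * p * (A + A') - 2 * q * (B + B') := by rw [hp, hq]; ring
  rw [e]
  nlinarith [sq_nonneg (3 * p * (A + A') + 2 * q * (B + B')),
    mul_le_mul_of_nonneg_right h1 (sq_nonneg (A + A')),
    mul_le_mul_of_nonneg_right h2 (sq_nonneg (B + B')), sq_nonneg (A + A')]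

lemma kstrip_meas (b : ℝ × ℝ → ℝ) (hb : Continuous b) :
    MeasurableSet {x : Fin 3 → ℝ | -b (x 0, x 1) < x 2 ∧ x 2 < 1} :=
  MeasurableSet.inter (s₁ := {x : Fin 3 → ℝ | -b (x 0, x 1) < x 2}) (s₂ := {x | x 2 < 1})
    (measurableSet_lt (by fun_prop) (by fun_prop)) (measurableSet_lt (by fun_prop) (by fun_prop))

lemma kcell_integral (L₁ L₂ : ℝ) (b : ℝ × ℝ → ℝ) (hb : Continuous b) (F : (Fin 3 → ℝ) → ℝ) :
    ∫ x in omegaCell L₁ L₂ b, F x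
      = ∫ x, {x : Fin 3 → ℝ | -b (x 0, x 1) < x 2 ∧ x 2 < 1}.indicator F x
        ∂(kmu (2 * Real.pi * L₁) (2 * Real.pi * L₂)) := by
  rw [integral_indicator (kstrip_meas b hb), kmu_eq,
    Measure.restrict_restrict (kstrip_meas b hb)]
  apply setIntegral_congr_set
  have h0 : ∀ᵐ x : Fin 3 → ℝ, x 0 ≠ 0 := Measure.ae_eval_ne (μ := fun _ : Fin 3 => (volume : Measure ℝ)) 0 0
  have h1 : ∀ᵐ x : Fin 3 → ℝ, x 1 ≠ 0 := Measure.ae_eval_ne (μ := fun _ : Fin 3 => (volume : Measure ℝ)) 1 0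
  refine Filter.eventuallyEq_set.2 ?_
  filter_upwards [h0, h1] with x hx0 hx1
  simp only [omegaCell, Set.mem_inter_iff, Set.mem_ofPred_eq, Set.mem_pi, Set.mem_univ,
    forall_true_left, Fin.forall_fin_succ, kbx, Set.mem_Icc]
  simp
  constructor
  · rintro ⟨⟨a1, a2⟩, ⟨a3, a4⟩, a5, a6⟩
    exact ⟨⟨a5, a6⟩, ⟨lt_of_le_of_ne a1 hx0.symm, a2⟩, lt_of_le_of_ne a3 hx1.symm, a4⟩
  · rintro ⟨⟨a5, a6⟩, ⟨a1, a2⟩, a3, a4⟩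
    exact ⟨⟨a1.le, a2⟩, ⟨a3.le, a4⟩, a5, a6⟩

lemma kS_facts (P Q B : ℝ) (hP : 0 < P) (hQ : 0 < Q) (b : ℝ × ℝ → ℝ) (hb : Continuous b)
    (hB : ∀ p, b p ≤ B)
    (u : (Fin 3 → ℝ) → (Fin 3 → ℝ)) (hu : ContDiff ℝ 1 u)
    (hf0 : ∀ x, u (x + P • (Pi.single 0 1 : Fin 3 → ℝ)) = u x)
    (hf1 : ∀ x, u (x + Q • (Pi.single 1 1 : Fin 3 → ℝ)) = u x) :
    Measurable (kS b u) ∧ (∃ C, ∀ x, |kS b u x| ≤ C) ∧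
      ∀ x : Fin 3 → ℝ, (x 2 ≤ -B ∨ 1 ≤ x 2) → kS b u x = 0 := by
  have huj : ∀ j, ContDiff ℝ 1 (fun z => u z j) := fun j => contDiff_pi.1 hu j
  refine ⟨?_, ?_, ?_⟩
  · have : ∀ i j, Measurable (kG b u i j) := by
      intro i j
      refine Measurable.ite (kstrip_meas b hb) ?_ measurable_const
      have := (huj j).continuous_fderiv (by norm_num)
      have c : Continuous (pd3 i (fun z => u z j)) := by
        unfold pd3; fun_prop
      exact c.measurable
    unfold kS
    fun_prop
  · have : ∀ j, ∃ C : NNReal, ∀ x : Fin 3 → ℝ, -B ≤ x 2 → x 2 ≤ 1 →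
        ‖fderiv ℝ (fun z => u z j) x‖₊ ≤ C := fun j =>
      kfderiv_bdd P Q B hP hQ (fun z => u z j) (huj j) (fun x => by rw [hf0]) (fun x => by rw [hf1])
    choose C hC using this
    have hG : ∀ i j x, |kG b u i j x| ≤ C j := by
      intro i j x
      unfold kG
      split_ifs with h
      · have h1 := hC j x (by linarith [h.1, hB (x 0, x 1)]) h.2.le
        have h2 : ‖fderiv ℝ (fun z => u z j) x‖ ≤ C j := by exact_mod_cast h1
        have h3 := (fderiv ℝ (fun z => u z j) x).le_opNorm (Pi.single i 1)
        rw [knorm_single, mul_one] at h3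
        exact h3.trans h2
      · simp
    refine ⟨∑ i, ∑ j, ((C j : ℝ) + C i) ^ 2, fun x => ?_⟩
    rw [abs_of_nonneg (kS_nonneg b u x)]
    refine Finset.sum_le_sum fun i _ => Finset.sum_le_sum fun j _ => ?_
    rw [← sq_abs]
    exact pow_le_pow_left₀ (abs_nonneg _)
      ((abs_add_le _ _).trans (add_le_add (hG i j x) (hG j i x))) 2
  · intro x hx
    have : ∀ i j, kG b u i j x = 0 := by
      intro i j
      rw [kG, if_neg]
      rintro ⟨h1, h2⟩
      have := hB (x 0, x 1)
      rcases hx with h | h <;> linarith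
    simp [kS, this]

/-- Korn's inequality: there is `C = C(L₁, L₂, b) > 0` so that for every `C¹`
horizontally periodic vector field `u` vanishing on the lower boundary `{x₃ = −b}`:
`∫_{Ω ∩ (Q×ℝ)} (|u|² + ‖∇u‖²) ≤ C ∫_{Ω ∩ (Q×ℝ)} |𝔻u|²`. -/
theorem stmt_10 (L₁ L₂ : ℝ) (hL₁ : 0 < L₁) (hL₂ : 0 < L₂)
    (b : ℝ × ℝ → ℝ) (hb : ContDiff ℝ (⊤ : ℕ∞) b) (hbpos : ∀ p : ℝ × ℝ, 0 < b p)
    (hbper₁ : ∀ p : ℝ × ℝ, b (p.1 + 2 * Real.pi * L₁, p.2) = b p)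
    (hbper₂ : ∀ p : ℝ × ℝ, b (p.1, p.2 + 2 * Real.pi * L₂) = b p) :
    ∃ C > 0, ∀ u : (Fin 3 → ℝ) → (Fin 3 → ℝ), ContDiff ℝ 1 u →
      (∀ x : Fin 3 → ℝ, u (x + (2 * Real.pi * L₁) • (Pi.single 0 1 : Fin 3 → ℝ)) = u x) →
      (∀ x : Fin 3 → ℝ, u (x + (2 * Real.pi * L₂) • (Pi.single 1 1 : Fin 3 → ℝ)) = u x) →
      (∀ p : ℝ × ℝ, u ![p.1, p.2, -b p] = 0) →
      (∫ x in omegaCell L₁ L₂ b,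
          ((∑ j : Fin 3, (u x j) ^ 2)
            + ∑ i : Fin 3, ∑ j : Fin 3, (pd3 i (fun z => u z j) x) ^ 2))
        ≤ C * ∫ x in omegaCell L₁ L₂ b,
            ∑ i : Fin 3, ∑ j : Fin 3,
              (pd3 i (fun z => u z j) x + pd3 j (fun z => u z i) x) ^ 2 := by
  set P : ℝ := 2 * Real.pi * L₁ with hPdef
  set Q : ℝ := 2 * Real.pi * L₂ with hQdef
  have hP : 0 < P := by have := Real.pi_pos; positivity
  have hQ : 0 < Q := by have := Real.pi_pos; positivity
  have hb1 : ContDiff ℝ 1 b := hb.of_le (by exact_mod_cast le_top)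
  have hbc : Continuous b := hb.continuous
  obtain ⟨⟨B, hB⟩, Kb, hKb⟩ := kb_facts P Q hP hQ b hb1 hbper₁ hbper₂
  have hB0 : 0 < B := (hbpos 0).trans_le (hB 0)
  refine ⟨(4 * (B + 3) ^ 2 + 1) * 193, by positivity, ?_⟩
  intro u hu hu0 hu1 hub
  choose K hK using kext_good P Q B hP hQ b hbpos hB hKb hbper₁ hbper₂ u hu hu0 hu1 hub
  obtain ⟨Sm, ⟨CS, SC⟩, Ss⟩ := kS_facts P Q B hP hQ b hbc hB u hu hu0 hu1
  rw [kcell_integral L₁ L₂ b hbc, kcell_integral L₁ L₂ b hbc, ← hPdef, ← hQdef]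
  have eS : ∀ x, {x : Fin 3 → ℝ | -b (x 0, x 1) < x 2 ∧ x 2 < 1}.indicator
      (fun x => ∑ i : Fin 3, ∑ j : Fin 3,
              (pd3 i (fun z => u z j) x + pd3 j (fun z => u z i) x) ^ 2) x = kS b u x := by
    intro x
    by_cases h : -b (x 0, x 1) < x 2 ∧ x 2 < 1
    · simp only [Set.indicator, Set.mem_ofPred_eq, kS, kG]
      simp only [if_pos h]
    · simp only [Set.indicator, Set.mem_ofPred_eq, kS, kG]
      simp only [if_neg h]
      simp
  simp_rw [eS]
  -- null sets
  have n1 := kmu_graph P Q (fun p => -b p) (by fun_prop)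
  have n2 := kmu_graph P Q (fun p => 2 + b p) (by fun_prop)
  have n3 := kmu_graph P Q (fun p => (3 + b p) / 2) (by fun_prop)
  have n4 := kmu_graph P Q (fun _ => 1) (by fun_prop)
  have im : ∀ i j k l, Integrable (fun x => kld (kext b u j) i x * kld (kext b u l) k x)
      (kmu P Q) := fun i j k l => (hK j).int_mul (hK l) i k
  have is : ∀ i j, Integrable (fun x => kld (kext b u j) i x ^ 2) (kmu P Q) := by
    intro i j; simpa only [sq] using im i j i j
  have step1 : ∫ x, {x : Fin 3 → ℝ | -b (x 0, x 1) < x 2 ∧ x 2 < 1}.indicator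
      (fun x => (∑ j : Fin 3, (u x j) ^ 2)
            + ∑ i : Fin 3, ∑ j : Fin 3, (pd3 i (fun z => u z j) x) ^ 2) x ∂(kmu P Q)
      ≤ ∫ x, (∑ j, kext b u j x ^ 2) + ∑ i, ∑ j, kld (kext b u j) i x ^ 2 ∂(kmu P Q) := by
    refine integral_mono_of_nonneg (Filter.Eventually.of_forall fun x => ?_) ?_ ?_
    · exact Set.indicator_nonneg (fun x _ => by positivity) x
    · exact (integrable_finsetSum _ fun j _ => (hK j).int_sq).add
        (integrable_finsetSum _ fun i _ => integrable_finsetSum _ fun j _ => is i j)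
    · filter_upwards [n1] with x hx
      by_cases h : -b (x 0, x 1) < x 2 ∧ x 2 < 1
      · rw [Set.indicator_of_mem (show x ∈ {x : Fin 3 → ℝ | -b (x 0, x 1) < x 2 ∧ x 2 < 1} from h)]
        refine le_of_eq ?_
        have ex : kN b id x = x := by
          simp only [kN, id]; rw [max_eq_left h.1.le]
          ext k; fin_cases k <;> rfl
        have e1 : ∀ j, kext b u j x = u x j := by
          intro j; rw [kext_low b u j x h.2.le, ex]
        have e2 : ∀ i j, kld (kext b u j) i x = pd3 i (fun z => u z j) x := by
          intro i j
          rw [kext_deriv_low b hbc u hu hub i j x hx h.2, kG, if_pos h]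
        simp only [e1, e2]
      · rw [Set.indicator_of_notMem (show x ∉ {x : Fin 3 → ℝ | -b (x 0, x 1) < x 2 ∧ x 2 < 1} from h)]
        positivity
  refine step1.trans ((kkorn hP hQ K (fun j => kext b u j) hK).trans ?_)
  rw [mul_assoc]
  refine mul_le_mul_of_nonneg_left ?_ (by positivity)
  have iS : Integrable (kS b u) (kmu P Q) := by
    refine kmu_integrable P Q (B + 3) CS _ Sm.aestronglyMeasurable SC fun x hx => Ss x ?_
    rcases lt_abs.1 hx with h | h
    · right; linarith
    · left; linarith
  have iS1 : Integrable (fun x => kS b u (kR1 x)) (kmu P Q) := by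
    have m : Measurable kR1 := by
      have : Continuous kR1 := by unfold kR1; fun_prop
      exact this.measurable
    refine kmu_integrable P Q (B + 3) CS _ (Sm.comp m).aestronglyMeasurable (fun x => SC _)
      fun x hx => Ss _ ?_
    simp only [kR1, Function.update_self]
    rcases lt_abs.1 hx with h | h
    · left; linarith
    · right; linarith
  have iS2 : Integrable (fun x => kS b u (kR2 x)) (kmu P Q) := by
    have m : Measurable kR2 := by
      have : Continuous kR2 := by unfold kR2; fun_prop
      exact this.measurable
    refine kmu_integrable P Q (B + 3) CS _ (Sm.comp m).aestronglyMeasurable (fun x => SC _)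
      fun x hx => Ss _ ?_
    simp only [kR2, Function.update_self]
    rcases lt_abs.1 hx with h | h
    · left; linarith
    · right; linarith
  have c1 : ∫ x, kS b u (kR1 x) ∂(kmu P Q) = 1 * ∫ x, kS b u x ∂(kmu P Q) := by
    refine kmu_cov P Q 2 (fun t => 2 - t) 1 (kS b u) iS iS1 fun y => ?_
    rw [knu_two, one_mul]
    exact integral_sub_left_eq_self (fun t => kS b u ((2 : Fin 3).insertNth t y)) volume 2
  have c2 : ∫ x, kS b u (kR2 x) ∂(kmu P Q) = (1 / 2) * ∫ x, kS b u x ∂(kmu P Q) := by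
    refine kmu_cov P Q 2 (fun t => 3 - 2 * t) (1 / 2) (kS b u) iS iS2 fun y => ?_
    rw [knu_two]
    have h1 := Measure.integral_comp_mul_left
      (fun t => kS b u ((2 : Fin 3).insertNth (3 - t) y)) 2
    rw [h1, integral_sub_left_eq_self (fun t => kS b u ((2 : Fin 3).insertNth t y)) volume 3]
    norm_num
  have step2 : ∫ x, ∑ i, ∑ j, (kld (kext b u j) i x + kld (kext b u i) j x) ^ 2 ∂(kmu P Q)
      ≤ ∫ x, (kS b u x + (128 * kS b u (kR1 x) + 128 * kS b u (kR2 x))) ∂(kmu P Q) := by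
    refine integral_mono_of_nonneg (Filter.Eventually.of_forall fun x => ?_)
      (iS.add ((iS1.const_mul 128).add (iS2.const_mul 128))) ?_
    · exact Finset.sum_nonneg fun i _ => Finset.sum_nonneg fun j _ => sq_nonneg _
    · filter_upwards [n1, n2, n3, n4] with x h1 h2 h3 h4
      rcases lt_or_gt_of_ne h4 with h | h
      · have e : ∑ i, ∑ j, (kld (kext b u j) i x + kld (kext b u i) j x) ^ 2 = kS b u x := by
          unfold kS
          refine Finset.sum_congr rfl fun i _ => Finset.sum_congr rfl fun j _ => ?_
          rw [kext_deriv_low b hbc u hu hub i j x h1 h, kext_deriv_low b hbc u hu hub j i x h1 h]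
        rw [e]
        linarith [kS_nonneg b u (kR1 x), kS_nonneg b u (kR2 x)]
      · have e : ∑ i, ∑ j, (kld (kext b u j) i x + kld (kext b u i) j x) ^ 2
            ≤ 128 * kS b u (kR1 x) + 128 * kS b u (kR2 x) := by
          unfold kS
          simp only [Finset.mul_sum, ← Finset.sum_add_distrib]
          refine Finset.sum_le_sum fun i _ => Finset.sum_le_sum fun j _ => ?_
          have g1 : 2 - x 2 ≠ -b (x 0, x 1) := fun h' => h2 (by linarith)
          have g2 : 3 - 2 * x 2 ≠ -b (x 0, x 1) := fun h' => h3 (by linarith)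
          rw [kext_deriv_high b hbc u hu hub i j x g1 g2 h,
            kext_deriv_high b hbc u hu hub j i x g1 g2 h]
          exact ksq_bound i j _ _ _ _
        linarith [kS_nonneg b u x]
  refine step2.trans ?_
  rw [integral_add iS (by exact (iS1.const_mul 128).add (iS2.const_mul 128)),
    integral_add (iS1.const_mul 128) (iS2.const_mul 128), integral_const_mul, integral_const_mul,
    c1, c2]
  linarith
end
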